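/- arXiv:1605.06631 — 2 statements merged into one kernel-verified Lean document; each statement's English description precedes it below -/
import Mathlib

section
/- For |q|<1, φ²(q)·φ²(q³) = 1 + 4·∑_{j≥1} ( j q^j/(1−q^j) − 2j q^{2j}/(1−q^{2j}) − 3j q^{3j}/(1−q^{3j}) + 4j q^{4j}/(1−q^{4j}) + 6j q^{6j}/(1−q^{6j}) − 12j q^{12j}/(1−q^{12j}) ). -/
noncomputable section

open Filter Topology

/-- The coefficient `(-1)^k q^{k(k-1)/2}` of the Jacobi theta series. -/
def thetaCoeff (q : ℂ) (k : ℤ) : ℂ := (-1) ^ k * q ^ (k * (k - 1) / 2)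

/-- The theta series `∑ (-1)^k q^{k(k-1)/2} z^k`. -/
def thetaSeries (q z : ℂ) : ℂ := ∑' k : ℤ, z ^ k * thetaCoeff q k

/-- The infinite product `∏_{n ≥ 1} (1 - x q^n)`. -/
def qProd (q x : ℂ) : ℂ := ∏' i : ℕ, (1 - x * q ^ (i + 1))

/-- The finite product `∏_{1 ≤ n ≤ N} (1 - q^n)`. -/
def qFact (q : ℂ) (n : ℕ) : ℂ := ∏ i ∈ Finset.range n, (1 - q ^ (i + 1))

/-- The Gaussian binomial coefficient. -/
def gaussBinom (q : ℂ) (m j : ℕ) : ℂ :=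
  if j ≤ m then qFact q m / (qFact q j * qFact q (m - j)) else 0

theorem thetaCoeff_zero (q : ℂ) : thetaCoeff q 0 = 1 := by simp [thetaCoeff]

theorem thetaCoeff_add_one {q : ℂ} (hq0 : q ≠ 0) (k : ℤ) :
    thetaCoeff q (k + 1) = -q ^ k * thetaCoeff q k := by
  have h : (k + 1) * (k + 1 - 1) / 2 = k * (k - 1) / 2 + k := by
    rw [show (k + 1) * (k + 1 - 1) = k * (k - 1) + k * 2 by ring,
      Int.add_mul_ediv_right _ _ (by norm_num)]
  rw [thetaCoeff, thetaCoeff, h, zpow_add₀ hq0, zpow_add₀ (by norm_num)]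
  simp; ring

theorem thetaCoeff_one_sub (q : ℂ) (k : ℤ) :
    thetaCoeff q (1 - k) = -thetaCoeff q k := by
  have h : (1 - k) * (1 - k - 1) = k * (k - 1) := by ring
  rw [thetaCoeff, thetaCoeff, h, zpow_sub₀ (by norm_num)]
  rcases Int.even_or_odd k with h | h <;> simp [h.neg_one_zpow]

theorem one_sub_pow_ne_zero {q : ℂ} (hq : ‖q‖ < 1) (n : ℕ) : 1 - q ^ (n + 1) ≠ 0 := by
  intro h
  have h1 : ‖q ^ (n + 1)‖ = 1 := by rw [← sub_eq_zero.mp h]; simp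
  rw [norm_pow] at h1
  exact absurd h1 (pow_lt_one₀ (norm_nonneg _) hq (by omega)).ne

theorem qFact_ne_zero {q : ℂ} (hq : ‖q‖ < 1) (n : ℕ) : qFact q n ≠ 0 :=
  Finset.prod_ne_zero_iff.mpr fun i _ ↦ one_sub_pow_ne_zero hq i

theorem qFact_succ (q : ℂ) (n : ℕ) : qFact q (n + 1) = qFact q n * (1 - q ^ (n + 1)) :=
  Finset.prod_range_succ _ _

theorem gaussBinom_zero_right {q : ℂ} (hq : ‖q‖ < 1) (m : ℕ) : gaussBinom q m 0 = 1 := by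
  have := qFact_ne_zero hq m
  simp [gaussBinom, qFact] at *
  exact this

theorem gaussBinom_of_lt (q : ℂ) {m j : ℕ} (h : m < j) : gaussBinom q m j = 0 := by
  simp [gaussBinom, h]

theorem gaussBinom_succ_succ {q : ℂ} (hq : ‖q‖ < 1) (m j : ℕ) :
    gaussBinom q (m + 1) (j + 1) = gaussBinom q m (j + 1) + q ^ (m - j) * gaussBinom q m j := by
  rcases lt_trichotomy m j with h | rfl | h
  · simp [gaussBinom_of_lt q h, gaussBinom_of_lt q (show m + 1 < j + 1 by omega),
      gaussBinom_of_lt q (show m < j + 1 by omega)]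
  · rw [gaussBinom_of_lt q (show m < m + 1 by omega)]
    have := qFact_ne_zero hq m
    have := qFact_ne_zero hq (m + 1)
    simp [gaussBinom]
    field_simp
  · obtain ⟨d, rfl⟩ := Nat.exists_eq_add_of_lt h
    have h1 := qFact_ne_zero hq j
    have h2 := qFact_ne_zero hq d
    have h3 := one_sub_pow_ne_zero hq j
    have h4 := one_sub_pow_ne_zero hq d
    simp only [gaussBinom, show j + 1 ≤ j + d + 1 + 1 by omega, show j + 1 ≤ j + d + 1 by omega,
      show j ≤ j + d + 1 by omega, if_true, show j + d + 1 + 1 - (j + 1) = d + 1 by omega,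
      show j + d + 1 - (j + 1) = d by omega, show j + d + 1 - j = d + 1 by omega,
      qFact_succ q (j + d + 1), qFact_succ q j, qFact_succ q d]
    field_simp
    ring

theorem gaussBinom_succ_succ' {q : ℂ} (hq : ‖q‖ < 1) (m j : ℕ) :
    gaussBinom q (m + 1) (j + 1) = q ^ (j + 1) * gaussBinom q m (j + 1) + gaussBinom q m j := by
  rcases lt_trichotomy m j with h | rfl | h
  · simp [gaussBinom_of_lt q h, gaussBinom_of_lt q (show m + 1 < j + 1 by omega),
      gaussBinom_of_lt q (show m < j + 1 by omega)]
  · rw [gaussBinom_of_lt q (show m < m + 1 by omega)]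
    have := qFact_ne_zero hq m
    have := qFact_ne_zero hq (m + 1)
    simp [gaussBinom]
    field_simp
  · obtain ⟨d, rfl⟩ := Nat.exists_eq_add_of_lt h
    have h1 := qFact_ne_zero hq j
    have h2 := qFact_ne_zero hq d
    have h3 := one_sub_pow_ne_zero hq j
    have h4 := one_sub_pow_ne_zero hq d
    simp only [gaussBinom, show j + 1 ≤ j + d + 1 + 1 by omega, show j + 1 ≤ j + d + 1 by omega,
      show j ≤ j + d + 1 by omega, if_true, show j + d + 1 + 1 - (j + 1) = d + 1 by omega,
      show j + d + 1 - (j + 1) = d by omega, show j + d + 1 - j = d + 1 by omega,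
      qFact_succ q (j + d + 1), qFact_succ q j, qFact_succ q d]
    field_simp
    ring

/-- The `q`-binomial theorem, centred at `0`. -/
theorem prod_mul_prod_eq_sum_gaussBinom {q z : ℂ} (hq0 : q ≠ 0) (hq : ‖q‖ < 1) (hz : z ≠ 0)
    (a b : ℕ) :
    (∏ i ∈ Finset.range a, (1 - z * q ^ i)) * ∏ i ∈ Finset.range b, (1 - z⁻¹ * q ^ (i + 1)) =
      ∑ j ∈ Finset.range (a + b + 1),
        z ^ ((j : ℤ) - b) * thetaCoeff q ((j : ℤ) - b) * gaussBinom q (a + b) j := by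
  induction b with
  | zero =>
    induction a with
    | zero => simp [thetaCoeff_zero, gaussBinom_zero_right hq]
    | succ a ih =>
      simp only [Finset.range_zero, Finset.prod_empty, mul_one, Nat.cast_zero, sub_zero,
        add_zero] at ih ⊢
      rw [Finset.prod_range_succ, ih, mul_sub, mul_one, Finset.sum_range_succ' _ (a + 1)]
      simp only [gaussBinom_succ_succ hq, mul_add, Finset.sum_add_distrib]
      have e1 : ∑ j ∈ Finset.range (a + 1), z ^ ((j : ℕ) : ℤ) * thetaCoeff q (j : ℤ) *
          gaussBinom q a j = ∑ j ∈ Finset.range (a + 1), z ^ ((j + 1 : ℕ) : ℤ) *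
          thetaCoeff q ((j + 1 : ℕ) : ℤ) * gaussBinom q a (j + 1) + 1 := by
        rw [Finset.sum_range_succ', Finset.sum_range_succ _ a,
          gaussBinom_of_lt q (show a < a + 1 by omega)]
        simp [thetaCoeff_zero, gaussBinom_zero_right hq]
      have e2 : (∑ j ∈ Finset.range (a + 1), z ^ ((j : ℕ) : ℤ) * thetaCoeff q (j : ℤ) *
          gaussBinom q a j) * (z * q ^ a) = - ∑ j ∈ Finset.range (a + 1), z ^ ((j + 1 : ℕ) : ℤ) *
          thetaCoeff q ((j + 1 : ℕ) : ℤ) * (q ^ (a - j) * gaussBinom q a j) := by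
        rw [Finset.sum_mul, ← Finset.sum_neg_distrib]
        refine Finset.sum_congr rfl fun j hj ↦ ?_
        have hj : j ≤ a := by simpa [Nat.lt_succ_iff] using hj
        obtain ⟨d, rfl⟩ := Nat.exists_eq_add_of_le hj
        push_cast
        rw [thetaCoeff_add_one hq0, zpow_add₀ hz, zpow_natCast, zpow_natCast, pow_add]
        simp
        ring
      rw [e2, e1]
      simp [thetaCoeff_zero, gaussBinom_zero_right hq]
      ring
  | succ b ih =>
    rw [Finset.prod_range_succ, ← mul_assoc, ih, mul_sub, mul_one, ← add_assoc a b 1,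
      Finset.sum_range_succ' _ (a + b + 1)]
    simp only [gaussBinom_succ_succ' hq, mul_add, Finset.sum_add_distrib]
    have e1 : (∑ j ∈ Finset.range (a + b + 1), z ^ ((j : ℤ) - b) * thetaCoeff q ((j : ℤ) - b) *
          gaussBinom q (a + b) j) * (z⁻¹ * q ^ (b + 1)) = - ∑ j ∈ Finset.range (a + b + 1),
          z ^ ((j : ℤ) - (b + 1 : ℕ)) * thetaCoeff q ((j : ℤ) - (b + 1 : ℕ)) *
          (q ^ j * gaussBinom q (a + b) j) := by
      rw [Finset.sum_mul, ← Finset.sum_neg_distrib]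
      refine Finset.sum_congr rfl fun j hj ↦ ?_
      have : (j : ℤ) - b = (j - (b + 1 : ℕ)) + 1 := by push_cast; ring
      have h2 : (q : ℂ) ^ j = q ^ ((j : ℤ) - (b + 1 : ℕ)) * q ^ (b + 1) := by
        rw [← zpow_natCast, ← zpow_natCast, ← zpow_add₀ hq0]; simp
      rw [this, thetaCoeff_add_one hq0, zpow_add₀ hz, h2]
      field_simp
    have e2 : ∑ j ∈ Finset.range (a + b + 1),
          z ^ ((j : ℤ) - (b + 1 : ℕ)) * thetaCoeff q ((j : ℤ) - (b + 1 : ℕ)) *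
          (q ^ j * gaussBinom q (a + b) j) = ∑ j ∈ Finset.range (a + b + 1),
          z ^ (((j + 1 : ℕ) : ℤ) - (b + 1 : ℕ)) * thetaCoeff q (((j + 1 : ℕ) : ℤ) - (b + 1 : ℕ)) *
          (q ^ (j + 1) * gaussBinom q (a + b) (j + 1)) + z ^ (((0 : ℕ) : ℤ) - (b + 1 : ℕ)) *
          thetaCoeff q (((0 : ℕ) : ℤ) - (b + 1 : ℕ)) := by
      rw [Finset.sum_range_succ', Finset.sum_range_succ _ (a + b),
        gaussBinom_of_lt q (show a + b < a + b + 1 by omega)]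
      simp [gaussBinom_zero_right hq]
    rw [e1, e2]
    simp [gaussBinom_zero_right hq]
    ring

theorem summable_norm_of_natAbs_le {x : ℤ → ℂ} {g : ℕ → ℝ} (hg : Summable g)
    (h : ∀ k, ‖x k‖ ≤ g k.natAbs) : Summable fun k ↦ ‖x k‖ := by
  refine Summable.of_nat_of_neg ?_ ?_ <;>
  refine Summable.of_nonneg_of_le (fun _ ↦ norm_nonneg _) (fun n ↦ ?_) hg
  · simpa using h n
  · simpa using h (-n)

theorem summable_norm_thetaCoeff_mul_pow {q : ℂ} (hq0 : q ≠ 0) (hq : ‖q‖ < 1) {r : ℝ}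
    (hr : 0 < r) : Summable fun n : ℕ ↦ ‖thetaCoeff q n‖ * r ^ n := by
  have hne : ∀ k, thetaCoeff q k ≠ 0 := fun k ↦
    mul_ne_zero (zpow_ne_zero _ (by norm_num)) (zpow_ne_zero _ hq0)
  refine summable_of_ratio_test_tendsto_lt_one (l := 0) one_pos
    (Eventually.of_forall fun n ↦ ?_) ?_
  · have := hne n
    positivity
  · have h : ∀ n : ℕ, ‖‖thetaCoeff q (n + 1 : ℕ)‖ * r ^ (n + 1)‖ / ‖‖thetaCoeff q n‖ * r ^ n‖ =
        ‖q‖ ^ n * r := by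
      intro n
      have := norm_ne_zero_iff.mpr (hne n)
      push_cast
      rw [thetaCoeff_add_one hq0]
      simp only [norm_mul, norm_neg, norm_pow, Real.norm_eq_abs, abs_of_pos hr,
        zpow_natCast, abs_norm]
      field_simp
      ring
    simp only [h]
    simpa using (tendsto_pow_atTop_nhds_zero_of_lt_one (norm_nonneg q) hq).mul_const r

theorem summable_norm_mul_thetaCoeff {q : ℂ} (hq0 : q ≠ 0) (hq : ‖q‖ < 1) {r : ℝ} (hr : 0 < r)
    {c : ℤ → ℂ} (hc : ∀ k, ‖c k‖ ≤ r ^ k.natAbs) : Summable fun k ↦ ‖c k * thetaCoeff q k‖ := by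
  have h1 := summable_norm_thetaCoeff_mul_pow hq0 hq hr
  have h2 := ((summable_nat_add_iff 1).mpr h1).mul_right r⁻¹
  refine summable_norm_of_natAbs_le (h1.add h2) fun k ↦ ?_
  rw [norm_mul, mul_comm]
  have key : ‖thetaCoeff q k‖ ≤
      ‖thetaCoeff q k.natAbs‖ + ‖thetaCoeff q (k.natAbs + 1 : ℕ)‖ := by
    rcases le_total 0 k with h | h
    · rw [Int.natAbs_of_nonneg h]
      linarith [norm_nonneg (thetaCoeff q (k.natAbs + 1 : ℕ))]
    · have : ((k.natAbs + 1 : ℕ) : ℤ) = 1 - k := by omega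
      rw [this, thetaCoeff_one_sub, norm_neg]
      linarith [norm_nonneg (thetaCoeff q k.natAbs)]
  calc ‖thetaCoeff q k‖ * ‖c k‖
      ≤ (‖thetaCoeff q k.natAbs‖ + ‖thetaCoeff q (k.natAbs + 1 : ℕ)‖) * r ^ k.natAbs :=
        mul_le_mul key (hc k) (norm_nonneg _) (by positivity)
    _ = _ := by
        field_simp
        ring

theorem norm_zpow_le (z : ℂ) (k : ℤ) : ‖z ^ k‖ ≤ (max ‖z‖ ‖z⁻¹‖) ^ k.natAbs := by
  rcases le_total 0 k with h | h
  · obtain ⟨n, rfl⟩ := Int.eq_ofNat_of_zero_le h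
    simpa using pow_le_pow_left₀ (norm_nonneg z) (le_max_left _ _) n
  · obtain ⟨n, rfl⟩ := Int.exists_eq_neg_ofNat h
    have := pow_le_pow_left₀ (norm_nonneg z⁻¹) (le_max_right ‖z‖ ‖z⁻¹‖) n
    simpa using this

theorem summable_norm_zpow_mul_thetaCoeff {q z : ℂ} (hq0 : q ≠ 0) (hq : ‖q‖ < 1) (hz : z ≠ 0) :
    Summable fun k : ℤ ↦ ‖z ^ k * thetaCoeff q k‖ :=
  summable_norm_mul_thetaCoeff hq0 hq (lt_max_of_lt_left (norm_pos_iff.mpr hz)) (norm_zpow_le z)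

theorem summable_norm_intCast_mul_thetaCoeff {q : ℂ} (hq0 : q ≠ 0) (hq : ‖q‖ < 1) :
    Summable fun k : ℤ ↦ ‖(k : ℂ) * thetaCoeff q k‖ := by
  refine summable_norm_mul_thetaCoeff hq0 hq two_pos fun k ↦ ?_
  have h : ‖(k : ℂ)‖ = k.natAbs := by
    rw [Complex.norm_intCast, Nat.cast_natAbs, Int.cast_abs]
  rw [h]
  exact_mod_cast Nat.lt_two_pow_self.le

theorem summable_norm_mul_pow_succ {q : ℂ} (hq : ‖q‖ < 1) (x : ℂ) :
    Summable fun i : ℕ ↦ ‖-(x * q ^ (i + 1))‖ := by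
  have := ((summable_nat_add_iff 1).mpr
    (summable_geometric_of_lt_one (norm_nonneg q) hq)).mul_left ‖x‖
  simpa using this

theorem multipliable_qProd {q : ℂ} (hq : ‖q‖ < 1) (x : ℂ) :
    Multipliable fun i : ℕ ↦ (1 - x * q ^ (i + 1)) := by
  simpa [sub_eq_add_neg] using multipliable_one_add_of_summable (summable_norm_mul_pow_succ hq x)

theorem tendsto_qProd {q : ℂ} (hq : ‖q‖ < 1) (x : ℂ) :
    Tendsto (fun n ↦ ∏ i ∈ Finset.range n, (1 - x * q ^ (i + 1))) atTop (𝓝 (qProd q x)) :=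
  (multipliable_qProd hq x).hasProd.tendsto_prod_nat

theorem qProd_ne_zero {q : ℂ} (hq : ‖q‖ < 1) {x : ℂ} (hx : ‖x‖ ≤ 1) : qProd q x ≠ 0 := by
  have := tprod_one_add_ne_zero_of_summable (f := fun i : ℕ ↦ -(x * q ^ (i + 1)))
    (fun i h ↦ ?_) (summable_norm_mul_pow_succ hq x)
  · simpa [qProd, sub_eq_add_neg] using this
  · have h1 : ‖x * q ^ (i + 1)‖ = 1 := by
      rw [← add_neg_eq_zero.mp h]; simp
    rw [norm_mul, norm_pow] at h1
    have h2 := pow_lt_one₀ (norm_nonneg q) hq (show i + 1 ≠ 0 by omega)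
    exact (mul_lt_one_of_nonneg_of_lt_one_right hx (by positivity) h2).ne h1

theorem tendsto_qFact {q : ℂ} (hq : ‖q‖ < 1) : Tendsto (qFact q) atTop (𝓝 (qProd q 1)) := by
  simpa [funext_iff, qFact] using! tendsto_qProd hq 1

theorem exists_norm_gaussBinom_le {q : ℂ} (hq : ‖q‖ < 1) :
    ∃ C : ℝ, ∀ m j, ‖gaussBinom q m j‖ ≤ C := by
  have h1 := tendsto_qFact hq
  have h2 := h1.inv₀ (qProd_ne_zero hq (by simp))
  obtain ⟨A, hA⟩ := (Metric.isBounded_range_of_tendsto _ h1).exists_norm_le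
  obtain ⟨B, hB⟩ := (Metric.isBounded_range_of_tendsto _ h2).exists_norm_le
  have hA0 : 0 ≤ A := (norm_nonneg _).trans (hA _ ⟨0, rfl⟩)
  have hB0 : 0 ≤ B := (norm_nonneg _).trans (hB _ ⟨0, rfl⟩)
  refine ⟨A * (B * B), fun m j ↦ ?_⟩
  unfold gaussBinom
  split_ifs
  · rw [div_eq_mul_inv, mul_inv, norm_mul, norm_mul]
    gcongr
    · exact hA _ ⟨_, rfl⟩
    · exact hB _ ⟨j, rfl⟩
    · exact hB _ ⟨m - j, rfl⟩
  · simpa using by positivity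

theorem tendsto_sum_gaussBinom {q : ℂ} (hq : ‖q‖ < 1) {f : ℤ → ℂ}
    (hf : Summable fun k ↦ ‖f k‖) :
    Tendsto (fun N : ℕ ↦ ∑ j ∈ Finset.range (N + 1 + N + 1),
      f ((j : ℤ) - N) * gaussBinom q (N + 1 + N) j) atTop (𝓝 ((∑' k, f k) / qProd q 1)) := by
  obtain ⟨C, hC⟩ := exists_norm_gaussBinom_le hq
  let G : ℕ → ℤ → ℂ := fun N k ↦
    if 0 ≤ k + N then f k * gaussBinom q (N + 1 + N) (k + N).toNat else 0
  have hG : ∀ N : ℕ, ∑ j ∈ Finset.range (N + 1 + N + 1),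
      f ((j : ℤ) - N) * gaussBinom q (N + 1 + N) j = ∑' k, G N k := by
    intro N
    have hinj : Function.Injective fun j : ℕ ↦ (j : ℤ) - N := fun a b h ↦ by
      simpa using h
    rw [← hinj.tsum_eq (f := G N), tsum_eq_sum (s := Finset.range (N + 1 + N + 1))]
    · refine Finset.sum_congr rfl fun j _ ↦ ?_
      simp [G]
    · intro j hj
      have : N + 1 + N < j := by simpa using hj
      simp [G, gaussBinom_of_lt q this]
    · intro k hk
      have h0 : 0 ≤ k + N := by
        by_contra h
        simp [G, h] at hk
      exact ⟨(k + N).toNat, by simp [h0]⟩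
  simp only [hG]
  rw [← tsum_div_const]
  refine tendsto_tsum_of_dominated_convergence (bound := fun k ↦ ‖f k‖ * C) (hf.mul_right C) ?_ ?_
  · intro k
    have hP := qProd_ne_zero hq (x := 1) (by simp)
    have t1 : Tendsto (fun N : ℕ ↦ N + 1 + N) atTop atTop :=
      tendsto_atTop_mono (fun N ↦ by simp only [id]; omega) tendsto_id
    have t2 : Tendsto (fun N : ℕ ↦ (k + N).toNat) atTop atTop :=
      tendsto_atTop_mono (f := fun N : ℕ ↦ N - k.natAbs) (fun N ↦ by omega)
        (tendsto_sub_atTop_nat _)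
    have t3 : Tendsto (fun N : ℕ ↦ N + 1 + N - (k + N).toNat) atTop atTop :=
      tendsto_atTop_mono (f := fun N : ℕ ↦ N - k.natAbs) (fun N ↦ by omega)
        (tendsto_sub_atTop_nat _)
    have key := ((((tendsto_qFact hq).comp t1).div
      (((tendsto_qFact hq).comp t2).mul ((tendsto_qFact hq).comp t3)) (mul_ne_zero hP hP))).const_mul
      (f k)
    have e : f k / qProd q 1 = f k * (qProd q 1 / (qProd q 1 * qProd q 1)) := by
      field_simp
    rw [e]
    refine key.congr' ?_
    filter_upwards [eventually_ge_atTop k.natAbs] with N hN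
    have h1 : 0 ≤ k + N := by omega
    have h2 : (k + N).toNat ≤ N + 1 + N := by omega
    simp [G, h1, gaussBinom]
    omega
  · refine Eventually.of_forall fun N k ↦ ?_
    simp only [G]
    split_ifs
    · rw [norm_mul]
      gcongr
      exact hC _ _
    · have := (norm_nonneg _).trans (hC 0 0)
      simpa using by positivity

theorem prod_eq_one_sub_mul (q z : ℂ) (N : ℕ) :
    ∏ i ∈ Finset.range (N + 1), (1 - z * q ^ i) =
      (1 - z) * ∏ i ∈ Finset.range N, (1 - z * q ^ (i + 1)) := by
  rw [Finset.prod_range_succ', mul_comm]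
  simp

/-- The Jacobi triple product identity. -/
theorem thetaSeries_eq_qProd {q z : ℂ} (hq0 : q ≠ 0) (hq : ‖q‖ < 1) (hz : z ≠ 0) :
    thetaSeries q z = (1 - z) * qProd q z * qProd q z⁻¹ * qProd q 1 := by
  have h1 := tendsto_sum_gaussBinom hq (summable_norm_zpow_mul_thetaCoeff hq0 hq hz)
  have h2 := ((tendsto_qProd hq z).const_mul (1 - z)).mul (tendsto_qProd hq z⁻¹)
  simp only [← prod_mul_prod_eq_sum_gaussBinom hq0 hq hz, prod_eq_one_sub_mul] at h1
  have := tendsto_nhds_unique h1 h2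
  rw [div_eq_iff (qProd_ne_zero hq (by simp))] at this
  exact this

/-- Jacobi's identity for the cube of the Euler product. -/
theorem tsum_intCast_mul_thetaCoeff {q : ℂ} (hq0 : q ≠ 0) (hq : ‖q‖ < 1) :
    ∑' k : ℤ, (k : ℂ) * thetaCoeff q k = -qProd q 1 ^ 3 := by
  have h1 := tendsto_sum_gaussBinom hq (summable_norm_intCast_mul_thetaCoeff hq0 hq)
  have h2 := ((tendsto_qFact hq).mul (tendsto_qFact hq)).neg
  have h3 : ∀ N : ℕ, ∑ j ∈ Finset.range (N + 1 + N + 1),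
      (((j : ℤ) - N : ℤ) : ℂ) * thetaCoeff q ((j : ℤ) - N) * gaussBinom q (N + 1 + N) j =
      -(qFact q N * qFact q N) := by
    intro N
    let R : ℂ → ℂ := fun z ↦ (∏ i ∈ Finset.range N, (1 - z * q ^ (i + 1))) *
      ∏ i ∈ Finset.range N, (1 - z⁻¹ * q ^ (i + 1))
    have hR : DifferentiableAt ℂ R 1 := by
      have : (1 : ℂ) ≠ 0 := one_ne_zero
      fun_prop (disch := assumption)
    have d1 : HasDerivAt (fun z ↦ (1 - z) * R z) (-(qFact q N * qFact q N)) 1 := by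
      have := ((hasDerivAt_id (1 : ℂ)).const_sub 1).mul hR.hasDerivAt
      convert! this using 1
      simp [R, qFact]
    have d2 : HasDerivAt (fun z : ℂ ↦ ∑ j ∈ Finset.range (N + 1 + N + 1),
        z ^ ((j : ℤ) - N) * thetaCoeff q ((j : ℤ) - N) * gaussBinom q (N + 1 + N) j)
        (∑ j ∈ Finset.range (N + 1 + N + 1),
      (((j : ℤ) - N : ℤ) : ℂ) * thetaCoeff q ((j : ℤ) - N) * gaussBinom q (N + 1 + N) j) 1 := by
      refine HasDerivAt.fun_sum fun j _ ↦ ?_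
      have := hasDerivAt_zpow ((j : ℤ) - N) (1 : ℂ) (Or.inl one_ne_zero)
      simpa using (this.mul_const (thetaCoeff q ((j : ℤ) - N))).mul_const
        (gaussBinom q (N + 1 + N) j)
    refine d2.unique (d1.congr_of_eventuallyEq ?_)
    filter_upwards [isOpen_ne.mem_nhds (one_ne_zero (α := ℂ))] with z hz
    rw [← prod_mul_prod_eq_sum_gaussBinom hq0 hq hz, prod_eq_one_sub_mul, mul_assoc]
  simp only [h3] at h1
  have := tendsto_nhds_unique h1 h2
  rw [div_eq_iff (qProd_ne_zero hq (by simp))] at this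
  rw [this]; ring

/-- Cauchy product of two absolutely convergent bilateral series. -/
theorem tsum_mul_tsum_int {x y : ℤ → ℂ} (hx : Summable fun k ↦ ‖x k‖)
    (hy : Summable fun k ↦ ‖y k‖) :
    (Summable fun k ↦ ∑' m, x m * y (k - m)) ∧
      (∑' k, x k) * (∑' k, y k) = ∑' k, ∑' m, x m * y (k - m) := by
  let e : ℤ × ℤ ≃ ℤ × ℤ :=
    { toFun := fun p ↦ (p.2, p.1 - p.2)
      invFun := fun p ↦ (p.1 + p.2, p.1)
      left_inv := fun p ↦ by simp
      right_inv := fun p ↦ by simp }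
  have h := summable_mul_of_summable_norm hx hy
  have h' : Summable fun p : ℤ × ℤ ↦ x p.2 * y (p.1 - p.2) := e.summable_iff.mpr h
  refine ⟨h'.prod, ?_⟩
  rw [tsum_mul_tsum_of_summable_norm hx hy, ← e.tsum_eq, ← h'.tsum_prod]
  rfl

theorem tsum_comp_sub_right (x : ℤ → ℂ) (m : ℤ) : ∑' k, x (k - m) = ∑' k, x k :=
  (Equiv.subRight m).tsum_eq x

theorem Summable.comp_sub_right {x : ℤ → ℂ} (hx : Summable x) (m : ℤ) :
    Summable fun k ↦ x (k - m) :=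
  (Equiv.subRight m).summable_iff.mpr hx

theorem tsum_comp_sub_left (x : ℤ → ℂ) (m : ℤ) : ∑' k, x (m - k) = ∑' k, x k :=
  (Equiv.subLeft m).tsum_eq x

/-- The kernel `1 / (1 + q^m)`. -/
def kron (q : ℂ) (m : ℤ) : ℂ := (1 + q ^ m)⁻¹

/-- The backward difference of `kron`. -/
def kronDiff (q : ℂ) (m : ℤ) : ℂ := kron q m - kron q (m - 1)

theorem norm_sub_le_norm_one_add_zpow {q : ℂ} (hq : ‖q‖ < 1) (n : ℕ) :
    1 - ‖q‖ ≤ ‖1 + q ^ n‖ := by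
  rcases Nat.eq_zero_or_pos n with rfl | h
  · norm_num
    linarith [norm_nonneg q]
  · have h1 : ‖q ^ n‖ ≤ ‖q‖ := by
      rw [norm_pow]; exact pow_le_of_le_one (norm_nonneg _) hq.le h.ne'
    have h2 := norm_sub_le_norm_add (1 : ℂ) (q ^ n)
    simp only [norm_one] at h2
    linarith

theorem one_add_pow_ne_zero {q : ℂ} (hq : ‖q‖ < 1) (n : ℕ) : 1 + q ^ n ≠ 0 := by
  have := norm_sub_le_norm_one_add_zpow hq n
  intro h
  rw [h, norm_zero] at this
  linarith

theorem one_add_zpow_ne_zero {q : ℂ} (hq0 : q ≠ 0) (hq : ‖q‖ < 1) (m : ℤ) : 1 + q ^ m ≠ 0 := by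
  rcases le_total 0 m with h | h
  · obtain ⟨n, rfl⟩ := Int.eq_ofNat_of_zero_le h
    exact_mod_cast one_add_pow_ne_zero hq n
  · obtain ⟨n, rfl⟩ := Int.exists_eq_neg_ofNat h
    have h1 := one_add_pow_ne_zero hq n
    intro h2
    apply h1
    rw [zpow_neg, zpow_natCast] at h2
    have : q ^ n ≠ 0 := pow_ne_zero _ hq0
    field_simp at h2
    rwa [mul_zero, add_comm] at h2

theorem kron_neg {q : ℂ} (hq0 : q ≠ 0) (hq : ‖q‖ < 1) (m : ℤ) :
    kron q (-m) = 1 - kron q m := by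
  have h1 := one_add_zpow_ne_zero hq0 hq m
  have h2 := one_add_zpow_ne_zero hq0 hq (-m)
  have h3 : q ^ m ≠ 0 := zpow_ne_zero _ hq0
  rw [zpow_neg] at h2
  rw [kron, kron, zpow_neg]
  have h4 : q ^ m + 1 ≠ 0 := by rwa [add_comm]
  field_simp
  ring

theorem kronDiff_one_sub {q : ℂ} (hq0 : q ≠ 0) (hq : ‖q‖ < 1) (m : ℤ) :
    kronDiff q (1 - m) = kronDiff q m := by
  rw [kronDiff, kronDiff, show 1 - m - 1 = -m by ring, show 1 - m = -(m - 1) by ring,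
    kron_neg hq0 hq, kron_neg hq0 hq]
  ring

theorem norm_kronDiff_le {q : ℂ} (hq : ‖q‖ < 1) (n : ℕ) :
    ‖kronDiff q (n + 1 : ℕ)‖ ≤ 2 / (1 - ‖q‖) ^ 2 * ‖q‖ ^ n := by
  have h1 := norm_sub_le_norm_one_add_zpow hq n
  have h2 := norm_sub_le_norm_one_add_zpow hq (n + 1)
  have h3 : 0 < 1 - ‖q‖ := by linarith
  have h4 : kronDiff q (n + 1 : ℕ) = q ^ n * (1 - q) / ((1 + q ^ n) * (1 + q ^ (n + 1))) := by
    have := one_add_pow_ne_zero hq n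
    have := one_add_pow_ne_zero hq (n + 1)
    rw [kronDiff, kron, kron, show ((n + 1 : ℕ) : ℤ) - 1 = n by push_cast; ring, zpow_natCast,
      zpow_natCast]
    field_simp
    ring
  have h5 : ‖1 - q‖ ≤ 2 := (norm_sub_le _ _).trans (by rw [norm_one]; linarith)
  rw [h4, norm_div, norm_mul, norm_mul, norm_pow, sq, div_mul_eq_mul_div, mul_comm 2]
  gcongr

theorem summable_norm_pow_mul_kronDiff {q : ℂ} (hq0 : q ≠ 0) (hq : ‖q‖ < 1) (p : ℕ) :
    Summable fun m : ℤ ↦ ‖(m : ℂ) ^ p * kronDiff q m‖ := by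
  have hs : Summable fun n : ℕ ↦ (n : ℝ) ^ p * ‖q‖ ^ n :=
    summable_pow_mul_geometric_of_norm_lt_one p (by simpa using hq)
  have hq' : 0 < ‖q‖ := norm_pos_iff.mpr hq0
  refine summable_norm_of_natAbs_le (hs.mul_left (2 / (1 - ‖q‖) ^ 2 / ‖q‖)) fun k ↦ ?_
  have key : ‖kronDiff q k‖ ≤ 2 / (1 - ‖q‖) ^ 2 / ‖q‖ * ‖q‖ ^ k.natAbs := by
    have h3 : 0 < 1 - ‖q‖ := by linarith
    rcases lt_or_ge 0 k with h | h
    · obtain ⟨n, rfl⟩ : ∃ n : ℕ, k = (n + 1 : ℕ) := ⟨(k - 1).toNat, by omega⟩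
      refine (norm_kronDiff_le hq n).trans_eq ?_
      rw [Int.natAbs_natCast, pow_succ]
      field_simp
      ring
    · obtain ⟨n, rfl⟩ := Int.exists_eq_neg_ofNat h
      rw [← kronDiff_one_sub hq0 hq, show 1 - -(n : ℤ) = (n + 1 : ℕ) by push_cast; ring]
      refine (norm_kronDiff_le hq n).trans ?_
      rw [Int.natAbs_neg, Int.natAbs_natCast]
      refine mul_le_mul_of_nonneg_right ?_ (by positivity)
      rw [le_div_iff₀ hq']
      exact mul_le_of_le_one_right (by positivity) hq.le
  have h : ‖(k : ℂ)‖ = k.natAbs := by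
    rw [Complex.norm_intCast, Nat.cast_natAbs, Int.cast_abs]
  rw [norm_mul, norm_pow, h]
  calc _ ≤ (k.natAbs : ℝ) ^ p * (2 / (1 - ‖q‖) ^ 2 / ‖q‖ * ‖q‖ ^ k.natAbs) := by gcongr
    _ = _ := by ring

theorem summable_norm_kronDiff {q : ℂ} (hq0 : q ≠ 0) (hq : ‖q‖ < 1) :
    Summable fun m : ℤ ↦ ‖kronDiff q m‖ := by
  simpa using summable_norm_pow_mul_kronDiff hq0 hq 0

theorem exists_norm_kron_le {q : ℂ} (hq0 : q ≠ 0) (hq : ‖q‖ < 1) :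
    ∃ C : ℝ, ∀ m, ‖kron q m‖ ≤ C := by
  have hn : ∀ n : ℕ, ‖kron q n‖ ≤ (1 - ‖q‖)⁻¹ := fun n ↦ by
    rw [kron, norm_inv, zpow_natCast]
    exact inv_anti₀ (by linarith) (norm_sub_le_norm_one_add_zpow hq n)
  refine ⟨1 + (1 - ‖q‖)⁻¹, fun m ↦ ?_⟩
  rcases le_total 0 m with h | h
  · obtain ⟨n, rfl⟩ := Int.eq_ofNat_of_zero_le h
    exact (hn n).trans (by linarith)
  · obtain ⟨n, rfl⟩ := Int.exists_eq_neg_ofNat h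
    rw [kron_neg hq0 hq]
    refine (norm_sub_le _ _).trans ?_
    simpa using hn n

theorem summable_kron_mul {q : ℂ} (hq0 : q ≠ 0) (hq : ‖q‖ < 1) {x : ℤ → ℂ}
    (hx : Summable fun k ↦ ‖x k‖) : Summable fun m ↦ kron q m * x m := by
  obtain ⟨C, hC⟩ := exists_norm_kron_le hq0 hq
  refine Summable.of_norm_bounded (hx.mul_left C) fun m ↦ ?_
  rw [norm_mul]
  gcongr
  exact hC m

theorem hasSum_kronDiff {q : ℂ} (hq0 : q ≠ 0) (hq : ‖q‖ < 1) : HasSum (kronDiff q) 1 := by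
  have hs := (summable_norm_kronDiff hq0 hq).of_norm
  have hn : Summable fun n : ℕ ↦ kronDiff q ((n : ℤ) + 1) := by
    have : Function.Injective fun n : ℕ ↦ (n : ℤ) + 1 := fun a b h ↦ by simpa using h
    exact hs.comp_injective this
  have h1 : HasSum (fun n : ℕ ↦ kronDiff q ((n : ℤ) + 1)) (1 / 2) := by
    refine (hn.hasSum_iff_tendsto_nat).mpr ?_
    have : ∀ n : ℕ, ∑ i ∈ Finset.range n, kronDiff q ((i : ℤ) + 1) = kron q n - kron q 0 := by
      intro n
      simpa [kronDiff] using Finset.sum_range_sub (fun i : ℕ ↦ kron q i) n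
    simp only [this]
    have t := tendsto_pow_atTop_nhds_zero_of_norm_lt_one hq
    have t2 := (((t.const_add 1).inv₀ (by simp)).sub_const (kron q 0))
    convert t2 using 2
    · simp [kron]
    · simp [kron]; norm_num
  have h2 : HasSum (fun n : ℕ ↦ kronDiff q (-(n : ℤ))) (1 / 2) := by
    convert! h1 using 2 with n
    rw [← kronDiff_one_sub hq0 hq]
    congr 1
    ring
  have := HasSum.of_nat_of_neg_add_one (f := fun m ↦ kronDiff q (m + 1)) h1 (by simpa using h2)
  rw [show (1 : ℂ) / 2 + 2⁻¹ = 1 by norm_num] at this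
  exact (Equiv.addRight (1 : ℤ)).hasSum_iff.mp this

/-- The Laurent series `(1 - z) ∑ z^m / (1 + q^m)`, written so that it converges on `‖z‖ = 1`. -/
def kronSeries (q z : ℂ) : ℂ := ∑' m : ℤ, z ^ m * kronDiff q m

theorem norm_zpow_mul {z : ℂ} (hz : ‖z‖ = 1) (m : ℤ) (w : ℂ) : ‖z ^ m * w‖ = ‖w‖ := by
  simp [hz]

theorem tsum_thetaCoeff (q : ℂ) :
    ∑' k : ℤ, thetaCoeff q k = 0 := by
  have := tsum_comp_sub_left (thetaCoeff q) 1
  simp only [thetaCoeff_one_sub, tsum_neg] at this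
  exact self_eq_neg.mp this.symm

theorem summable_norm_thetaCoeff {q : ℂ} (hq0 : q ≠ 0) (hq : ‖q‖ < 1) :
    Summable fun k : ℤ ↦ ‖thetaCoeff q k‖ := by
  simpa using summable_norm_zpow_mul_thetaCoeff hq0 hq (one_ne_zero)

/-- The convolution of `kron` and `thetaCoeff`. -/
def kronTheta (q : ℂ) (k : ℤ) : ℂ := ∑' m, kron q m * thetaCoeff q (k - m)

theorem summable_kron_mul_thetaCoeff {q : ℂ} (hq0 : q ≠ 0) (hq : ‖q‖ < 1) (k : ℤ) :
    Summable fun m ↦ kron q m * thetaCoeff q (k - m) :=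
  summable_kron_mul hq0 hq
    ((Equiv.subLeft k).summable_iff.mpr (summable_norm_thetaCoeff hq0 hq))

theorem kronTheta_add_one {q : ℂ} (hq0 : q ≠ 0) (hq : ‖q‖ < 1) (k : ℤ) :
    kronTheta q (k + 1) = q ^ k * kronTheta q k := by
  rw [← sub_eq_zero, kronTheta, kronTheta, ← tsum_mul_left,
    ← (summable_kron_mul_thetaCoeff hq0 hq _).tsum_sub
      ((summable_kron_mul_thetaCoeff hq0 hq _).mul_left _),
    ← tsum_thetaCoeff q, ← tsum_comp_sub_left (thetaCoeff q) (k + 1)]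
  refine tsum_congr fun m ↦ ?_
  have h1 := one_add_zpow_ne_zero hq0 hq m
  have h2 : q ^ k = q ^ (k - m) * q ^ m := by rw [← zpow_add₀ hq0]; simp
  rw [kron, show k + 1 - m = (k - m) + 1 by ring, thetaCoeff_add_one hq0, h2]
  field_simp
  ring

theorem kronTheta_eq {q : ℂ} (hq0 : q ≠ 0) (hq : ‖q‖ < 1) (k : ℤ) :
    kronTheta q k = (-1) ^ k * thetaCoeff q k * kronTheta q 0 := by
  induction k using Int.induction_on with
  | zero => simp [thetaCoeff_zero]
  | succ n ih =>
    rw [kronTheta_add_one hq0 hq, ih, thetaCoeff_add_one hq0, zpow_add₀ (by norm_num)]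
    simp
    ring
  | pred n ih =>
    have h1 := kronTheta_add_one hq0 hq (-n - 1)
    have h2 := thetaCoeff_add_one hq0 (-n - 1)
    have h3 : ((-1 : ℂ)) ^ (-n - 1 + 1 : ℤ) = -(-1) ^ (-n - 1 : ℤ) := by
      rw [zpow_add₀ (by norm_num)]; simp
    rw [sub_add_cancel] at h1 h2 h3
    rw [ih, h2, h3] at h1
    refine mul_left_cancel₀ (zpow_ne_zero (-n - 1 : ℤ) hq0) ?_
    rw [← h1]
    ring

theorem tsum_kronDiff_mul_thetaCoeff {q : ℂ} (hq0 : q ≠ 0) (hq : ‖q‖ < 1) (k : ℤ) :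
    ∑' m, kronDiff q m * thetaCoeff q (k - m) = kronTheta q k - kronTheta q (k - 1) := by
  have h1 := summable_kron_mul_thetaCoeff hq0 hq k
  have h2 := (summable_kron_mul_thetaCoeff hq0 hq (k - 1)).comp_sub_right 1
  rw [kronTheta, kronTheta, ← tsum_comp_sub_right (fun m ↦ kron q m * thetaCoeff q (k - 1 - m)) 1,
    ← h1.tsum_sub h2]
  refine tsum_congr fun m ↦ ?_
  rw [kronDiff, show k - 1 - (m - 1) = k - m by ring]
  ring

theorem summable_zpow_mul_kronTheta {q z : ℂ} (hq0 : q ≠ 0) (hq : ‖q‖ < 1) (hz : z ≠ 0) :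
    Summable fun k : ℤ ↦ z ^ k * kronTheta q k := by
  have := (summable_norm_zpow_mul_thetaCoeff hq0 hq (neg_ne_zero.mpr hz)).of_norm.mul_right
    (kronTheta q 0)
  refine this.congr fun k ↦ ?_
  rw [kronTheta_eq hq0 hq k, neg_eq_neg_one_mul z, mul_zpow]
  ring

theorem tsum_zpow_mul_kronTheta {q : ℂ} (hq0 : q ≠ 0) (hq : ‖q‖ < 1) (z : ℂ) :
    ∑' k : ℤ, z ^ k * kronTheta q k = kronTheta q 0 * thetaSeries q (-z) := by
  rw [thetaSeries, ← tsum_mul_left]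
  refine tsum_congr fun k ↦ ?_
  rw [kronTheta_eq hq0 hq k, neg_eq_neg_one_mul z, mul_zpow]
  ring

/-- Kronecker's identity with one parameter equal to `-1`, up to the constant `kronTheta q 0`. -/
theorem kronSeries_mul_thetaSeries {q z : ℂ} (hq0 : q ≠ 0) (hq : ‖q‖ < 1) (hz : ‖z‖ = 1) :
    kronSeries q z * thetaSeries q z = (1 - z) * (kronTheta q 0 * thetaSeries q (-z)) := by
  have hz0 : z ≠ 0 := by rintro rfl; simp at hz
  have hx : Summable fun m : ℤ ↦ ‖z ^ m * kronDiff q m‖ := by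
    simpa only [norm_zpow_mul hz] using summable_norm_kronDiff hq0 hq
  rw [kronSeries, thetaSeries, (tsum_mul_tsum_int hx
    (summable_norm_zpow_mul_thetaCoeff hq0 hq hz0)).2, ← tsum_zpow_mul_kronTheta hq0 hq]
  have hs := summable_zpow_mul_kronTheta hq0 hq hz0
  have e : ∀ k : ℤ, ∑' m : ℤ, z ^ m * kronDiff q m * (z ^ (k - m) * thetaCoeff q (k - m)) =
      z ^ k * kronTheta q k - z * (z ^ (k - 1) * kronTheta q (k - 1)) := by
    intro k
    have h1 : z * z ^ (k - 1) = z ^ k := by rw [← zpow_one_add₀ hz0]; congr 1; ring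
    rw [← mul_assoc, h1, ← mul_sub, ← tsum_kronDiff_mul_thetaCoeff hq0 hq, ← tsum_mul_left]
    refine tsum_congr fun m ↦ ?_
    have : z ^ k = z ^ m * z ^ (k - m) := by rw [← zpow_add₀ hz0]; simp
    rw [this]; ring
  simp only [e]
  rw [hs.tsum_sub ((hs.comp_sub_right 1).mul_left z), tsum_mul_left,
    tsum_comp_sub_right (fun k ↦ z ^ k * kronTheta q k)]
  ring

theorem kronTheta_mul_thetaSeries {q : ℂ} (hq0 : q ≠ 0) (hq : ‖q‖ < 1) :
    kronTheta q 0 * thetaSeries q (-1) = qProd q 1 ^ 3 := by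
  have hd := summable_norm_kronDiff hq0 hq
  have hd1 : Summable fun m : ℤ ↦ ‖(m : ℂ) * kronDiff q m‖ := by
    simpa using summable_norm_pow_mul_kronDiff hq0 hq 1
  have ht := summable_norm_thetaCoeff hq0 hq
  have ht1 := summable_norm_intCast_mul_thetaCoeff hq0 hq
  obtain ⟨s1, c1⟩ := tsum_mul_tsum_int hd1 ht
  obtain ⟨s2, c2⟩ := tsum_mul_tsum_int hd ht1
  rw [tsum_thetaCoeff q, mul_zero] at c1
  rw [(hasSum_kronDiff hq0 hq).tsum_eq, tsum_intCast_mul_thetaCoeff hq0 hq, one_mul] at c2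
  have hk : Summable fun k : ℤ ↦ kronTheta q k := by
    simpa using summable_zpow_mul_kronTheta hq0 hq (one_ne_zero)
  have hkk : Summable fun k : ℤ ↦ (k : ℂ) * kronTheta q k := by
    refine Summable.of_norm (((ht1.mul_right ‖kronTheta q 0‖)).congr fun k ↦ ?_)
    rw [kronTheta_eq hq0 hq k]
    simp [mul_assoc]
  have e : ∀ k : ℤ, ∑' m : ℤ, (m : ℂ) * kronDiff q m * thetaCoeff q (k - m) +
      ∑' m : ℤ, kronDiff q m * (((k - m : ℤ) : ℂ) * thetaCoeff q (k - m)) =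
      k * kronTheta q k - (((k - 1 : ℤ) : ℂ) * kronTheta q (k - 1) + kronTheta q (k - 1)) := by
    intro k
    have a1 : Summable fun m : ℤ ↦ (m : ℂ) * kronDiff q m * thetaCoeff q (k - m) := by
      obtain ⟨C, hC⟩ : ∃ C : ℝ, ∀ m, ‖thetaCoeff q m‖ ≤ C :=
        ⟨_, fun m ↦ ht.le_tsum m fun _ _ ↦ norm_nonneg _⟩
      refine Summable.of_norm_bounded (hd1.mul_right C) fun m ↦ ?_
      rw [norm_mul]; gcongr; exact hC _
    have a2 : Summable fun m : ℤ ↦ kronDiff q m * (((k - m : ℤ) : ℂ) * thetaCoeff q (k - m)) := by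
      obtain ⟨C, hC⟩ : ∃ C : ℝ, ∀ m : ℤ, ‖(m : ℂ) * thetaCoeff q m‖ ≤ C :=
        ⟨_, fun m ↦ ht1.le_tsum m fun _ _ ↦ norm_nonneg _⟩
      refine Summable.of_norm_bounded (hd.mul_right C) fun m ↦ ?_
      rw [norm_mul]; gcongr; exact hC _
    rw [← a1.tsum_add a2]
    have : (k : ℂ) * kronTheta q k - (((k - 1 : ℤ) : ℂ) * kronTheta q (k - 1) + kronTheta q (k - 1))
        = k * (kronTheta q k - kronTheta q (k - 1)) := by push_cast; ring
    rw [this, ← tsum_kronDiff_mul_thetaCoeff hq0 hq, ← tsum_mul_left]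
    refine tsum_congr fun m ↦ ?_
    push_cast; ring
  have key := s1.tsum_add s2
  simp only [e] at key
  rw [← c1, ← c2, hkk.tsum_sub ((hkk.comp_sub_right 1).add (hk.comp_sub_right 1)),
    (hkk.comp_sub_right 1).tsum_add (hk.comp_sub_right 1),
    tsum_comp_sub_right (fun k ↦ (k : ℂ) * kronTheta q k), tsum_comp_sub_right (kronTheta q)] at key
  have h2 := tsum_zpow_mul_kronTheta hq0 hq 1
  simp only [one_zpow, one_mul] at h2
  rw [h2] at key
  linear_combination -key

theorem qProd_mul_qProd_neg {q : ℂ} (hq : ‖q‖ < 1) :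
    qProd q 1 * qProd q (-1) = qProd (q ^ 2) 1 := by
  rw [qProd, qProd, qProd, ← (multipliable_qProd hq 1).tprod_mul (multipliable_qProd hq (-1))]
  exact tprod_congr fun i ↦ by ring

theorem norm_pow_lt_one {q : ℂ} (hq : ‖q‖ < 1) {n : ℕ} (hn : n ≠ 0) : ‖q ^ n‖ < 1 := by
  rw [norm_pow]; exact pow_lt_one₀ (norm_nonneg _) hq hn

/-- Gauss's product for `∑ (-q)^{n²}`. -/
theorem tsum_neg_zpow_sq_mul_qProd {q : ℂ} (hq0 : q ≠ 0) (hq : ‖q‖ < 1) :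
    (∑' n : ℤ, (-q) ^ (n ^ 2)) * qProd q (-1) = qProd q 1 := by
  have hq2 := norm_pow_lt_one hq two_ne_zero
  have hT : ∑' n : ℤ, (-q) ^ (n ^ 2) = thetaSeries (q ^ 2) q := by
    refine tsum_congr fun n ↦ ?_
    have h1 : (q ^ 2 : ℂ) ^ (n * (n - 1) / 2) = q ^ (n * (n - 1)) := by
      rw [← zpow_natCast q 2, ← zpow_mul]
      congr 1
      exact Int.mul_ediv_cancel' (even_iff_two_dvd.mp (Int.even_mul_pred_self n))
    have h2 : (-1 : ℂ) ^ (n ^ 2) = (-1) ^ n := by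
      rcases Int.even_or_odd n with h | h
      · rw [h.neg_one_zpow, (h.pow_of_ne_zero two_ne_zero).neg_one_zpow]
      · rw [h.neg_one_zpow, h.pow.neg_one_zpow]
    rw [thetaCoeff, h1, neg_eq_neg_one_mul q, mul_zpow, h2,
      show n ^ 2 = n + n * (n - 1) by ring, zpow_add₀ hq0]
    ring
  let o : ℂ := ∏' i : ℕ, (1 - q⁻¹ * (q ^ 2) ^ (i + 1))
  have ho : ∀ i : ℕ, 1 - q⁻¹ * (q ^ 2) ^ (i + 1) = 1 - 1 * q ^ (2 * i + 1) := fun i ↦ by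
    field_simp; ring
  have h1 : (1 - q) * qProd (q ^ 2) q = o := by
    have hs : ∀ i : ℕ, 1 - q * (q ^ 2) ^ (i + 1) = 1 - q⁻¹ * (q ^ 2) ^ (i + 1 + 1) := fun i ↦ by
      field_simp; ring
    have e := tprod_eq_zero_mul' (f := fun i : ℕ ↦ 1 - q⁻¹ * (q ^ 2) ^ (i + 1))
      ((multipliable_qProd hq2 q).congr hs)
    refine Eq.trans ?_ e.symm
    congr 1
    · field_simp; ring
    · exact tprod_congr hs
  have h2 : qProd q 1 = o * qProd (q ^ 2) 1 := by
    have e : ∀ i : ℕ, 1 - 1 * (q ^ 2) ^ (i + 1) = 1 - 1 * q ^ (2 * i + 1 + 1) := fun i ↦ by ring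
    have m1 := multipliable_qProd hq2 q⁻¹
    have m2 := multipliable_qProd hq2 1
    simp only [o, qProd]
    simp only [ho, e] at m1 m2 ⊢
    exact (tprod_even_mul_odd (f := fun i ↦ 1 - 1 * q ^ (i + 1)) m1 m2).symm
  have h3 := qProd_mul_qProd_neg hq
  have h4 : qProd (q ^ 2) q⁻¹ = o := rfl
  have h5 : qProd (q ^ 2) 1 ≠ 0 := qProd_ne_zero hq2 (by simp)
  have h6 : o * qProd q (-1) = 1 := by
    refine mul_left_cancel₀ h5 ?_
    rw [← mul_assoc, mul_comm _ o, ← h2, h3, mul_one]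
  rw [hT, thetaSeries_eq_qProd (pow_ne_zero 2 hq0) hq2 hq0, h1, h4, h2]
  linear_combination (o * qProd (q ^ 2) 1) * h6

theorem qProd_mul_three {q : ℂ} (hq : ‖q‖ < 1) {a : ℂ} (ha : a ^ 2 - a + 1 = 0) (x : ℂ) :
    qProd q (a * x) * qProd q (a⁻¹ * x) * qProd q (-x) = qProd (q ^ 3) (-x ^ 3) := by
  have hinv : a⁻¹ = 1 - a := inv_eq_of_mul_eq_one_left (by linear_combination -ha)
  simp only [qProd]
  rw [← (multipliable_qProd hq _).tprod_mul (multipliable_qProd hq _),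
    ← ((multipliable_qProd hq _).mul (multipliable_qProd hq _)).tprod_mul
      (multipliable_qProd hq _)]
  refine tprod_congr fun i ↦ ?_
  rw [hinv]
  linear_combination (-(x ^ 2 * (q ^ (i + 1)) ^ 2 * (1 + x * q ^ (i + 1)))) * ha

theorem norm_eq_one_of_sq {a : ℂ} (ha : a ^ 2 - a + 1 = 0) : ‖a‖ = 1 := by
  have : a ^ 6 = 1 := by linear_combination (a ^ 4 + a ^ 3 - a - 1) * ha
  exact Complex.norm_eq_one_of_pow_eq_one this (by norm_num)

/-- Lorenz's theorem on the form `x² + 3y²`, as an identity of series. -/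
theorem kronSeries_eq {q a : ℂ} (hq0 : q ≠ 0) (hq : ‖q‖ < 1) (ha : a ^ 2 - a + 1 = 0) :
    2 * kronSeries q a =
      (1 + a) * ((∑' n : ℤ, (-q) ^ (n ^ 2)) * ∑' n : ℤ, (-q ^ 3) ^ (n ^ 2)) := by
  have hq3 := norm_pow_lt_one hq three_ne_zero
  have ha1 := norm_eq_one_of_sq ha
  have ha0 : a ≠ 0 := by rintro rfl; simp at ha1
  have ham : 1 - a ≠ 0 := by
    intro h
    rw [← sub_eq_zero.mp h] at ha
    norm_num at ha
  have g1 := tsum_neg_zpow_sq_mul_qProd hq0 hq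
  have g3 := tsum_neg_zpow_sq_mul_qProd (pow_ne_zero 3 hq0) hq3
  have k1 := kronSeries_mul_thetaSeries hq0 hq ha1
  have k2 := kronTheta_mul_thetaSeries hq0 hq
  rw [thetaSeries_eq_qProd hq0 hq (by norm_num), inv_neg, inv_one] at k2
  rw [thetaSeries_eq_qProd hq0 hq ha0, thetaSeries_eq_qProd hq0 hq (neg_ne_zero.mpr ha0),
    inv_neg] at k1
  have p1 := qProd_mul_three hq ha 1
  have p2 := qProd_mul_three hq ha (-1)
  norm_num at p1 p2
  have P1 : qProd q 1 ≠ 0 := qProd_ne_zero hq (by simp)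
  have M1 : qProd q (-1) ≠ 0 := qProd_ne_zero hq (by simp)
  have M3 : qProd (q ^ 3) (-1) ≠ 0 := qProd_ne_zero hq3 (by simp)
  rw [← eq_div_iff M1] at g1 p1
  rw [← eq_div_iff M3] at g3
  rw [g1, g3]
  have k2' : kronTheta q 0 = qProd q 1 ^ 2 / (2 * qProd q (-1) ^ 2) := by
    rw [eq_div_iff (mul_ne_zero two_ne_zero (pow_ne_zero 2 M1))]
    refine mul_right_cancel₀ P1 ?_
    linear_combination k2
  have k1' : kronSeries q a * ((1 - a) * (qProd (q ^ 3) (-1) / qProd q (-1)) * qProd q 1) =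
      (1 - a) * (kronTheta q 0 * ((1 + a) * qProd (q ^ 3) 1)) := by
    rw [← p1, ← p2]
    linear_combination k1
  rw [k2'] at k1'
  field_simp at k1' ⊢
  linear_combination k1'

/-- The self-convolution of `kron`. -/
def kronSq (q : ℂ) (k : ℤ) : ℂ := ∑' m, kron q m * kron q (k - m)

theorem one_sub_zpow_mul_kron_mul_kron {q : ℂ} (hq0 : q ≠ 0) (hq : ‖q‖ < 1) (k m : ℤ) :
    (1 - q ^ k) * (kron q m * kron q (k - m)) = kron q m - kron q (m - k) := by
  have h1 := one_add_zpow_ne_zero hq0 hq m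
  have h2 := one_add_zpow_ne_zero hq0 hq (k - m)
  have h3 : q ^ k = q ^ m * q ^ (k - m) := by rw [← zpow_add₀ hq0]; simp
  rw [← neg_sub k m, kron_neg hq0 hq, kron, kron, h3]
  field_simp
  ring

theorem summable_kron_mul_kron {q : ℂ} (hq0 : q ≠ 0) (hq : ‖q‖ < 1) (k : ℤ) :
    Summable fun m ↦ kron q m * kron q (k - m) := by
  have hd := summable_norm_kronDiff hq0 hq
  have hkd : ∀ k, Summable fun m ↦ kron q m * kronDiff q (k - m) := fun k ↦
    summable_kron_mul hq0 hq ((Equiv.subLeft k).summable_iff.mpr hd)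
  induction k using Int.inductionOn' (b := 1) with
  | zero =>
    have h1 : 1 - q ≠ 0 := by simpa using one_sub_pow_ne_zero hq 0
    refine (hd.of_norm.mul_left (1 - q)⁻¹).congr fun m ↦ ?_
    have := one_sub_zpow_mul_kron_mul_kron hq0 hq 1 m
    rw [zpow_one] at this
    rw [kronDiff, ← this, inv_mul_cancel_left₀ h1]
  | succ k _ ih =>
    refine (ih.add (hkd (k + 1))).congr fun m ↦ ?_
    rw [kronDiff, show k + 1 - m - 1 = k - m by ring]
    ring
  | pred k _ ih =>
    refine (ih.sub (hkd k)).congr fun m ↦ ?_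
    rw [kronDiff, show k - 1 - m = k - m - 1 by ring]
    ring

theorem hasSum_kron_sub_kron {q : ℂ} (hq0 : q ≠ 0) (hq : ‖q‖ < 1) (k : ℤ) :
    HasSum (fun m ↦ kron q m - kron q (m - k)) k := by
  have h : ∀ k : ℤ, HasSum (fun m ↦ kronDiff q (m - k)) 1 := fun k ↦
    ((Equiv.subRight k).hasSum_iff (f := kronDiff q)).mpr (hasSum_kronDiff hq0 hq)
  induction k using Int.induction_on with
  | zero => simp
  | succ n ih =>
    have e : (fun m ↦ kron q m - kron q (m - (n + 1))) =
        fun m ↦ (kron q m - kron q (m - n)) + kronDiff q (m - n) := by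
      funext m
      rw [kronDiff, show m - (n : ℤ) - 1 = m - (n + 1) by ring]
      ring
    rw [e]
    rw [Int.cast_add, Int.cast_one]
    exact ih.add (h n)
  | pred n ih =>
    have e : (fun m ↦ kron q m - kron q (m - (-n - 1))) =
        fun m ↦ (kron q m - kron q (m - -n)) - kronDiff q (m - (-n - 1)) := by
      funext m
      rw [kronDiff, show m - (-(n : ℤ) - 1) - 1 = m - -n by ring]
      ring
    rw [e]
    rw [Int.cast_sub, Int.cast_one]
    exact ih.sub (h (-n - 1))

theorem one_sub_zpow_mul_kronSq {q : ℂ} (hq0 : q ≠ 0) (hq : ‖q‖ < 1) (k : ℤ) :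
    (1 - q ^ k) * kronSq q k = k := by
  rw [kronSq, ← tsum_mul_left, ← (hasSum_kron_sub_kron hq0 hq k).tsum_eq]
  exact tsum_congr fun m ↦ one_sub_zpow_mul_kron_mul_kron hq0 hq k m

theorem tsum_kronDiff_mul_kronDiff {q : ℂ} (hq0 : q ≠ 0) (hq : ‖q‖ < 1) (k : ℤ) :
    ∑' m, kronDiff q m * kronDiff q (k - m) =
      kronSq q k - 2 * kronSq q (k - 1) + kronSq q (k - 2) := by
  have h0 := summable_kron_mul_kron hq0 hq k
  have h1 := summable_kron_mul_kron hq0 hq (k - 1)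
  have h2 := h1.comp_sub_right 1
  have h3 := (summable_kron_mul_kron hq0 hq (k - 2)).comp_sub_right 1
  have e1 : kronSq q (k - 1) = ∑' m, kron q (m - 1) * kron q (k - 1 - (m - 1)) :=
    (tsum_comp_sub_right (fun m ↦ kron q m * kron q (k - 1 - m)) 1).symm
  have e2 : kronSq q (k - 2) = ∑' m, kron q (m - 1) * kron q (k - 2 - (m - 1)) :=
    (tsum_comp_sub_right (fun m ↦ kron q m * kron q (k - 2 - m)) 1).symm
  rw [two_mul, ← sub_sub]
  nth_rw 2 [e1]
  rw [e2, kronSq, kronSq, ← h0.tsum_sub h1, ← (h0.sub h1).tsum_sub h2,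
    ← ((h0.sub h1).sub h2).tsum_add h3]
  refine tsum_congr fun m ↦ ?_
  rw [kronDiff, kronDiff, show k - 1 - (m - 1) = k - m by ring,
    show k - 2 - (m - 1) = k - m - 1 by ring, show k - 1 - m = k - m - 1 by ring]
  ring

/-- The bounded part `|k| q^|k| / (1 - q^|k|)` of `kronSq`. -/
def kronRem (q : ℂ) (k : ℤ) : ℂ := kronSq q k - (max k 0 : ℤ)

theorem kronRem_natCast {q : ℂ} (hq0 : q ≠ 0) (hq : ‖q‖ < 1) (n : ℕ) :
    kronRem q (n + 1 : ℕ) = (n + 1) * q ^ (n + 1) / (1 - q ^ (n + 1)) := by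
  have h1 := one_sub_pow_ne_zero hq n
  have h := one_sub_zpow_mul_kronSq hq0 hq (n + 1 : ℕ)
  rw [zpow_natCast, mul_comm, ← eq_div_iff h1] at h
  rw [kronRem, h, max_eq_left (by omega)]
  push_cast
  field_simp
  ring

theorem kronRem_neg_natCast {q : ℂ} (hq0 : q ≠ 0) (hq : ‖q‖ < 1) (n : ℕ) :
    kronRem q (-(n + 1 : ℕ)) = kronRem q (n + 1 : ℕ) := by
  have h1 := one_sub_pow_ne_zero hq n
  have h := one_sub_zpow_mul_kronSq hq0 hq (-(n + 1 : ℕ))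
  have h2 : q ^ (n + 1) ≠ 0 := pow_ne_zero _ hq0
  rw [kronRem_natCast hq0 hq, kronRem, max_eq_right (by omega), eq_div_iff h1]
  rw [zpow_neg, zpow_natCast] at h
  push_cast at h ⊢
  field_simp at h
  linear_combination -h

theorem summable_norm_kronRem {q : ℂ} (hq0 : q ≠ 0) (hq : ‖q‖ < 1) :
    Summable fun k ↦ ‖kronRem q k‖ := by
  have hs : Summable fun n : ℕ ↦ (n : ℝ) ^ 1 * ‖q‖ ^ n :=
    summable_pow_mul_geometric_of_norm_lt_one 1 (by simpa using hq)
  have h : Summable fun n : ℕ ↦ ‖kronRem q n‖ := by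
    refine (summable_nat_add_iff 1).mp ?_
    refine Summable.of_nonneg_of_le (fun _ ↦ norm_nonneg _) (fun n ↦ ?_)
      (((summable_nat_add_iff 1).mpr hs).mul_left (1 - ‖q‖)⁻¹)
    have h3 : 0 < 1 - ‖q‖ := by linarith
    have h4 : 1 - ‖q‖ ≤ ‖1 - q ^ (n + 1)‖ := by
      have h5 := norm_sub_norm_le 1 (q ^ (n + 1))
      rw [norm_one, norm_pow] at h5
      have := pow_le_of_le_one (norm_nonneg q) hq.le (show n + 1 ≠ 0 by omega)
      linarith
    rw [kronRem_natCast hq0 hq, norm_div, norm_mul, norm_pow, div_eq_inv_mul,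
      show ‖(n : ℂ) + 1‖ = ((n + 1 : ℕ) : ℝ) by rw [← Complex.norm_natCast]; push_cast; rfl, pow_one]
    gcongr
  refine summable_norm_of_natAbs_le h fun k ↦ ?_
  rcases le_total 0 k with h | h
  · rw [Int.natAbs_of_nonneg h]
  · obtain ⟨n, rfl⟩ := Int.exists_eq_neg_ofNat h
    rw [Int.natAbs_neg, Int.natAbs_natCast]
    cases n with
    | zero => simp
    | succ n => rw [kronRem_neg_natCast hq0 hq]

theorem summable_zpow_mul_kronRem {q z : ℂ} (hq0 : q ≠ 0) (hq : ‖q‖ < 1) (hz : ‖z‖ = 1) :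
    Summable fun k : ℤ ↦ z ^ k * kronRem q k := by
  refine Summable.of_norm ?_
  simpa only [norm_zpow_mul hz] using summable_norm_kronRem hq0 hq

/-- The square of `kronSeries` as a Lambert series. -/
theorem kronSeries_sq {q z : ℂ} (hq0 : q ≠ 0) (hq : ‖q‖ < 1) (hz : ‖z‖ = 1) :
    kronSeries q z ^ 2 = z + (1 - z) ^ 2 * ∑' k : ℤ, z ^ k * kronRem q k := by
  have hz0 : z ≠ 0 := by rintro rfl; simp at hz
  have hx : Summable fun m : ℤ ↦ ‖z ^ m * kronDiff q m‖ := by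
    simpa only [norm_zpow_mul hz] using summable_norm_kronDiff hq0 hq
  have hs := summable_zpow_mul_kronRem hq0 hq hz
  rw [sq, kronSeries, (tsum_mul_tsum_int hx hx).2]
  have e : ∀ k : ℤ, ∑' m : ℤ, z ^ m * kronDiff q m * (z ^ (k - m) * kronDiff q (k - m)) =
      (if k = 1 then z else 0) + (z ^ k * kronRem q k - 2 * z * (z ^ (k - 1) * kronRem q (k - 1)) +
        z ^ 2 * (z ^ (k - 2) * kronRem q (k - 2))) := by
    intro k
    have h1 : z ^ (k - 1) = z ^ k / z := zpow_sub_one₀ hz0 k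
    have h2 : z ^ (k - 2) = z ^ k / z ^ 2 := by rw [zpow_sub₀ hz0]; rfl
    have h3 : ∑' m : ℤ, z ^ m * kronDiff q m * (z ^ (k - m) * kronDiff q (k - m)) =
        z ^ k * (kronSq q k - 2 * kronSq q (k - 1) + kronSq q (k - 2)) := by
      rw [← tsum_kronDiff_mul_kronDiff hq0 hq, ← tsum_mul_left]
      refine tsum_congr fun m ↦ ?_
      have : z ^ k = z ^ m * z ^ (k - m) := by rw [← zpow_add₀ hz0]; simp
      rw [this]; ring
    have h4 : z ^ k * ((max k 0 - 2 * max (k - 1) 0 + max (k - 2) 0 : ℤ) : ℂ) =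
        if k = 1 then z else 0 := by
      split_ifs with h
      · subst h; norm_num
      · rw [show (max k 0 - 2 * max (k - 1) 0 + max (k - 2) 0 : ℤ) = 0 by omega]; simp
    rw [h3, ← h4, h1, h2, kronRem, kronRem, kronRem]
    push_cast
    field_simp
    ring
  have s1 := (hs.comp_sub_right 1).mul_left (2 * z)
  have s2 := (hs.comp_sub_right 2).mul_left (z ^ 2)
  have s0 : Summable fun k : ℤ ↦ if k = 1 then z else 0 := (hasSum_ite_eq 1 z).summable
  simp only [e]
  rw [s0.tsum_add ((hs.sub s1).add s2), (hs.sub s1).tsum_add s2, hs.tsum_sub s1, tsum_mul_left,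
    tsum_mul_left, tsum_comp_sub_right (fun k ↦ z ^ k * kronRem q k),
    tsum_comp_sub_right (fun k ↦ z ^ k * kronRem q k), tsum_ite_eq]
  ring

theorem kronSeries_neg_one {q : ℂ} (hq0 : q ≠ 0) (hq : ‖q‖ < 1) : kronSeries q (-1) = 0 := by
  have h := kronSeries_mul_thetaSeries hq0 hq (z := -1) (by simp)
  have h2 : thetaSeries q 1 = 0 := by simp [thetaSeries, tsum_thetaCoeff]
  rw [neg_neg, h2, mul_zero, mul_zero] at h
  refine (mul_eq_zero.mp h).resolve_right fun h3 ↦ ?_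
  have h4 := kronTheta_mul_thetaSeries hq0 hq
  rw [h3, mul_zero] at h4
  exact pow_ne_zero 3 (qProd_ne_zero hq (by simp)) h4.symm

theorem hasSum_zpow_mul_kronRem {q z : ℂ} (hq0 : q ≠ 0) (hq : ‖q‖ < 1) (hz : ‖z‖ = 1) :
    HasSum (fun n : ℕ ↦ (z ^ (n + 1) + z⁻¹ ^ (n + 1)) *
        ((n + 1) * q ^ (n + 1) / (1 - q ^ (n + 1))))
      (∑' k : ℤ, z ^ k * kronRem q k - kronRem q 0) := by
  have s := summable_zpow_mul_kronRem hq0 hq hz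
  have i1 : Function.Injective fun n : ℕ ↦ (n : ℤ) + 1 := fun a b h ↦ by simpa using h
  have i2 : Function.Injective fun n : ℕ ↦ -((n : ℤ) + 1) := fun a b h ↦ by simpa using h
  have u1 : Summable fun n : ℕ ↦ z ^ ((n : ℤ) + 1) * kronRem q ((n : ℤ) + 1) :=
    s.comp_injective i1
  have u2 : Summable fun n : ℕ ↦ z ^ (-((n : ℤ) + 1)) * kronRem q (-((n : ℤ) + 1)) :=
    s.comp_injective i2
  have e : ∑' k : ℤ, z ^ k * kronRem q k - kronRem q 0 =
      ∑' n : ℕ, z ^ ((n : ℤ) + 1) * kronRem q ((n : ℤ) + 1) +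
        ∑' n : ℕ, z ^ (-((n : ℤ) + 1)) * kronRem q (-((n : ℤ) + 1)) := by
    rw [tsum_of_add_one_of_neg_add_one (f := fun k : ℤ ↦ z ^ k * kronRem q k) u1 u2, zpow_zero]
    ring
  have hf : (fun n : ℕ ↦ (z ^ (n + 1) + z⁻¹ ^ (n + 1)) *
        ((n + 1) * q ^ (n + 1) / (1 - q ^ (n + 1)))) =
      fun n : ℕ ↦ z ^ ((n : ℤ) + 1) * kronRem q ((n : ℤ) + 1) +
        z ^ (-((n : ℤ) + 1)) * kronRem q (-((n : ℤ) + 1)) := funext fun n ↦ ?_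
  · rw [e, hf]
    exact u1.hasSum.add u2.hasSum
  have r1 := kronRem_natCast hq0 hq n
  have r2 := kronRem_neg_natCast hq0 hq n
  have p1 : z ^ ((n : ℤ) + 1) = z ^ (n + 1) := by rw [← zpow_natCast, Nat.cast_succ]
  have p2 : z ^ (-((n : ℤ) + 1)) = z⁻¹ ^ (n + 1) := by
    rw [← inv_zpow', ← zpow_natCast, Nat.cast_succ]
  push_cast at r1 r2
  rw [r2, r1, p1, p2]
  ring

theorem theta_sq_mul_theta_sq {q a : ℂ} (hq0 : q ≠ 0) (hq : ‖q‖ < 1) (ha : a ^ 2 - a + 1 = 0) :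
    ((∑' n : ℤ, (-q) ^ (n ^ 2)) * ∑' n : ℤ, (-q ^ 3) ^ (n ^ 2)) ^ 2 =
      1 + 4 * ∑' n : ℕ, (2 * (-1) ^ (n + 1) - a ^ (n + 1) - a⁻¹ ^ (n + 1)) / 3 *
        ((n + 1) * q ^ (n + 1) / (1 - q ^ (n + 1))) := by
  have ha1 := norm_eq_one_of_sq ha
  have ha0 : a ≠ 0 := by rintro rfl; simp at ha1
  have h1 := kronSeries_eq hq0 hq ha
  have h2 := kronSeries_sq hq0 hq ha1
  have h3 := kronSeries_sq hq0 hq (z := -1) (by simp)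
  rw [kronSeries_neg_one hq0 hq] at h3
  have s1 := hasSum_zpow_mul_kronRem hq0 hq (z := -1) (by simp)
  have s2 := hasSum_zpow_mul_kronRem hq0 hq ha1
  have e : ∑' n : ℕ, (2 * (-1) ^ (n + 1) - a ^ (n + 1) - a⁻¹ ^ (n + 1)) / 3 *
      ((n + 1) * q ^ (n + 1) / (1 - q ^ (n + 1))) =
      (∑' k : ℤ, (-1) ^ k * kronRem q k - ∑' k : ℤ, a ^ k * kronRem q k) / 3 := by
    rw [← sub_sub_sub_cancel_right _ _ (kronRem q 0), ← ((s1.sub s2).div_const 3).tsum_eq]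
    refine tsum_congr fun n ↦ ?_
    rw [inv_neg, inv_one]
    ring
  rw [e]
  generalize (∑' n : ℤ, (-q) ^ (n ^ 2)) * ∑' n : ℤ, (-q ^ 3) ^ (n ^ 2) = X at h1 ⊢
  have h4 : 4 * kronSeries q a ^ 2 = 3 * a * X ^ 2 := by
    linear_combination (2 * kronSeries q a + (1 + a) * X) * h1 + X ^ 2 * ha
  refine mul_left_cancel₀ (mul_ne_zero three_ne_zero ha0) ?_
  rw [← h4, h2]
  linear_combination (4 * ∑' k : ℤ, a ^ k * kronRem q k) * ha + a * h3

/-- The term `n q^n / (1 - q^n)` of a Lambert series. -/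
def lambertTerm (q : ℂ) (n : ℕ) : ℂ := n * q ^ n / (1 - q ^ n)

theorem lambertTerm_zero (q : ℂ) : lambertTerm q 0 = 0 := by simp [lambertTerm]

theorem summable_lambertTerm {q : ℂ} (hq0 : q ≠ 0) (hq : ‖q‖ < 1) :
    Summable (lambertTerm q) := by
  rw [← summable_nat_add_iff 1]
  have h := (summable_norm_kronRem hq0 hq).of_norm.comp_injective
    (i := fun n : ℕ ↦ ((n + 1 : ℕ) : ℤ)) fun a b h ↦ by simpa using h
  refine h.congr fun n ↦ ?_
  rw [Function.comp_apply, kronRem_natCast hq0 hq, lambertTerm]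
  push_cast
  rfl

theorem hasSum_mul_succ_iff {f : ℕ → ℂ} (hf : f 0 = 0) {k : ℕ} (hk : k ≠ 0) {s : ℂ} :
    HasSum (fun j ↦ f (k * (j + 1))) s ↔ HasSum (fun n ↦ if k ∣ n then f n else 0) s := by
  have hi : Function.Injective fun j ↦ k * (j + 1) := fun a b h ↦ by
    simpa [hk] using h
  rw [← hi.hasSum_iff (f := fun n ↦ if k ∣ n then f n else 0)]
  · simp [Function.comp_def]
  · intro n hn
    split_ifs with h
    · obtain ⟨j, rfl⟩ := h
      cases j with
      | zero => rw [mul_zero, hf]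
      | succ j => exact absurd ⟨j, rfl⟩ hn
    · rfl

theorem hasSum_ite_of_summable {f : ℕ → ℂ} (hf : Summable f) (p : ℕ → Prop) [DecidablePred p] :
    HasSum (fun n ↦ if p n then f n else 0) (∑' n, if p n then f n else 0) := by
  refine Summable.hasSum ((hf.indicator {n | p n}).congr fun n ↦ ?_)
  simp [Set.indicator_apply]

theorem hasSum_lambertTerm_mul {q : ℂ} (hq0 : q ≠ 0) (hq : ‖q‖ < 1) {k : ℕ} (hk : k ≠ 0) :
    HasSum (fun j : ℕ ↦ k * ((j : ℂ) + 1) * q ^ (k * (j + 1)) / (1 - q ^ (k * (j + 1))))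
      (∑' n, if k ∣ n then lambertTerm q n else 0) := by
  have h := (hasSum_mul_succ_iff (lambertTerm_zero q) hk).mpr
    (hasSum_ite_of_summable (summable_lambertTerm hq0 hq) (k ∣ ·))
  simpa [lambertTerm] using h

theorem exists_sq_sub_add_one : ∃ a : ℂ, a ^ 2 - a + 1 = 0 := by
  obtain ⟨s, hs⟩ := IsAlgClosed.exists_pow_nat_eq (-3 : ℂ) two_pos
  exact ⟨(1 + s) / 2, by linear_combination hs / 4⟩

theorem lambert_coeff {a : ℂ} (ha : a ^ 2 - a + 1 = 0) (n : ℕ) :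
    (2 * (-1) ^ n - a ^ n - a⁻¹ ^ n) / 3 = if 3 ∣ n then 0 else (-1) ^ n := by
  have hinv : a⁻¹ = 1 - a := inv_eq_of_mul_eq_one_left (by linear_combination -ha)
  have h1 : a ^ 3 = -1 := by linear_combination (a + 1) * ha
  have h2 : (1 - a) ^ 3 = -1 := by linear_combination (2 - a) * ha
  rw [hinv, ← Nat.div_add_mod n 3]
  simp only [pow_add, pow_mul, h1, h2, show (-1 : ℂ) ^ 3 = -1 by norm_num]
  have h3 : n % 3 < 3 := Nat.mod_lt _ (by norm_num)
  simp only [Nat.dvd_add_right (Dvd.intro _ rfl : 3 ∣ 3 * (n / 3))]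
  generalize (-1 : ℂ) ^ (n / 3) = e
  interval_cases n % 3
  · simp only [pow_zero, mul_one, dvd_zero, if_true]
    ring
  · norm_num
    ring
  · norm_num
    linear_combination (-(2 * e) / 3) * ha

theorem lambert_coeff_mul {q : ℂ} (hq : ‖q‖ < 1) (n : ℕ) :
    (if 3 ∣ n then 0 else (-1) ^ n) * lambertTerm (-q) n =
      (if 3 ∣ n then 0 else lambertTerm q n) -
        if 3 ∣ n ∨ 2 ∣ n then 0 else lambertTerm q (2 * n) := by
  by_cases h3 : 3 ∣ n
  · simp [h3]
  by_cases h2 : 2 ∣ n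
  · have := even_iff_two_dvd.mpr h2
    simp [h3, h2, lambertTerm, this.neg_pow]
  · have h := Nat.not_even_iff_odd.mp (mt even_iff_two_dvd.mp h2)
    obtain ⟨m, rfl⟩ : ∃ m, n = m + 1 := ⟨n - 1, by have := h.pos; omega⟩
    have h4 := one_sub_pow_ne_zero hq m
    have h5 := one_sub_pow_ne_zero (q := -q) (by simpa using hq) m
    have h6 := one_sub_pow_ne_zero hq (2 * m + 1)
    rw [h.neg_pow] at h5
    rw [show 2 * m + 1 + 1 = 2 * (m + 1) by ring, mul_comm 2, pow_mul] at h6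
    simp only [h3, h2, lambertTerm, h.neg_pow, or_self, if_false, mul_comm 2 (m + 1), pow_mul]
    push_cast
    have h7 : 1 - (q ^ (m + 1)) ^ 2 = (1 - q ^ (m + 1)) * (1 - -q ^ (m + 1)) := by ring
    rw [h7, one_pow]
    field_simp
    ring

theorem tsum_lambert_coeff_mul {q : ℂ} (hq0 : q ≠ 0) (hq : ‖q‖ < 1) :
    ∑' n, (if 3 ∣ n then 0 else (-1) ^ n) * lambertTerm (-q) n =
      ∑' n, lambertTerm q n - (∑' n, if 2 ∣ n then lambertTerm q n else 0)
        - (∑' n, if 3 ∣ n then lambertTerm q n else 0)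
        + (∑' n, if 4 ∣ n then lambertTerm q n else 0)
        + (∑' n, if 6 ∣ n then lambertTerm q n else 0)
        - ∑' n, if 12 ∣ n then lambertTerm q n else 0 := by
  have hs := summable_lambertTerm hq0 hq
  have hi : ∀ (p : ℕ → Prop) [DecidablePred p],
      HasSum (fun n ↦ if p n then lambertTerm q n else 0)
        (∑' n, if p n then lambertTerm q n else 0) := hasSum_ite_of_summable hs
  have h2 : HasSum (fun n ↦ if 3 ∣ n ∨ 2 ∣ n then 0 else lambertTerm q (2 * n))
      (∑' n, if 2 ∣ n ∧ ¬ 3 ∣ n ∧ ¬ 4 ∣ n then lambertTerm q n else 0) := by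
    have := hi fun n ↦ 2 ∣ n ∧ ¬ 3 ∣ n ∧ ¬ 4 ∣ n
    have hj : Function.Injective fun n : ℕ ↦ 2 * n := fun a b h ↦ by simpa using h
    rw [← hj.hasSum_iff] at this
    · refine (congrArg (HasSum · _) (funext fun n ↦ ?_)).mp this
      rw [Function.comp_apply]
      split_ifs <;> first | rfl | omega
    · intro n hn
      refine if_neg fun h ↦ hn ?_
      obtain ⟨m, rfl⟩ := h.1
      exact ⟨m, rfl⟩
  have h1 := hi fun n ↦ ¬ 3 ∣ n
  have H := (((((hs.hasSum.sub (hi (2 ∣ ·))).sub (hi (3 ∣ ·))).add (hi (4 ∣ ·))).add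
    (hi (6 ∣ ·))).sub (hi (12 ∣ ·)))
  rw [← H.tsum_eq]
  trans (∑' n, if ¬ 3 ∣ n then lambertTerm q n else 0) -
    ∑' n, if 2 ∣ n ∧ ¬ 3 ∣ n ∧ ¬ 4 ∣ n then lambertTerm q n else 0
  · rw [← (h1.sub h2).tsum_eq]
    exact tsum_congr fun n ↦ by rw [lambert_coeff_mul hq, ite_not]
  · rw [← (h1.sub (hi fun n ↦ 2 ∣ n ∧ ¬ 3 ∣ n ∧ ¬ 4 ∣ n)).tsum_eq]
    refine tsum_congr fun n ↦ ?_
    have d6 : 6 ∣ n ↔ 2 ∣ n ∧ 3 ∣ n := by omega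
    have d12 : 12 ∣ n ↔ 4 ∣ n ∧ 3 ∣ n := by omega
    have d4 : 4 ∣ n → 2 ∣ n := by omega
    by_cases c3 : 3 ∣ n <;> by_cases c2 : 2 ∣ n <;> by_cases c4 : 4 ∣ n <;>
      simp_all

theorem statement4 (q : ℂ) (hq : ‖q‖ < 1) :
    (∑' n : ℤ, (q) ^ (n ^ 2)) ^ 2 * (∑' n : ℤ, (q ^ 3) ^ (n ^ 2)) ^ 2 =
      1 + 4 * ∑' j : ℕ,
        (((j : ℂ) + 1) * q ^ (1 * (j + 1)) / (1 - q ^ (1 * (j + 1))) - 2 * ((j : ℂ) + 1) * q ^ (2 * (j + 1)) / (1 - q ^ (2 * (j + 1))) - 3 * ((j : ℂ) + 1) * q ^ (3 * (j + 1)) / (1 - q ^ (3 * (j + 1)))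
          + 4 * ((j : ℂ) + 1) * q ^ (4 * (j + 1)) / (1 - q ^ (4 * (j + 1))) + 6 * ((j : ℂ) + 1) * q ^ (6 * (j + 1)) / (1 - q ^ (6 * (j + 1))) - 12 * ((j : ℂ) + 1) * q ^ (12 * (j + 1)) / (1 - q ^ (12 * (j + 1)))) := by
  rcases eq_or_ne q 0 with rfl | hq0
  · have h : ∑' n : ℤ, (0 : ℂ) ^ (n ^ 2) = 1 := by
      rw [tsum_eq_single 0 fun n hn ↦ zero_zpow _ (pow_ne_zero 2 hn)]
      simp
    simp [h]
  obtain ⟨a, ha⟩ := exists_sq_sub_add_one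
  have key := theta_sq_mul_theta_sq (neg_ne_zero.mpr hq0) (by simpa using hq) ha
  rw [neg_neg, show -(-q) ^ 3 = q ^ 3 by ring] at key
  rw [← mul_pow, key]
  congr 2
  have e : ∑' n : ℕ, (2 * (-1) ^ (n + 1) - a ^ (n + 1) - a⁻¹ ^ (n + 1)) / 3 *
      ((n + 1) * (-q) ^ (n + 1) / (1 - (-q) ^ (n + 1))) =
      ∑' n, (if 3 ∣ n then 0 else (-1) ^ n) * lambertTerm (-q) n := by
    have h0 : Function.support (fun n ↦ (if 3 ∣ n then 0 else (-1) ^ n) * lambertTerm (-q) n) ⊆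
        Set.range (· + 1) := by
      intro n hn
      cases n with
      | zero => simp at hn
      | succ n => exact ⟨n, rfl⟩
    rw [← (add_left_injective 1).tsum_eq h0]
    refine tsum_congr fun n ↦ ?_
    rw [lambert_coeff ha, lambertTerm]
    push_cast
    rfl
  have H : ∀ {k : ℕ}, k ≠ 0 → _ := fun {k} hk ↦ hasSum_lambertTerm_mul hq0 hq (k := k) hk
  have H1 := H one_ne_zero
  have H2 := H two_ne_zero
  have H3 := H three_ne_zero
  have H4 := H four_ne_zero
  have H6 := H (k := 6) (by norm_num)
  have H12 := H (k := 12) (by norm_num)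
  simp only [one_dvd, if_true, Nat.cast_one, one_mul, Nat.cast_ofNat] at H1 H2 H3 H4 H6 H12
  simp only [one_mul]
  rw [e, tsum_lambert_coeff_mul hq0 hq,
    (((((H1.sub H2).sub H3).add H4).add H6).sub H12).tsum_eq]
end
end

section
/- For |q|<1, q·ψ²(q)·ψ²(q³) = ∑_{j≥1} ( j q^j/(1−q^j) − j q^{2j}/(1−q^{2j}) − 3j q^{3j}/(1−q^{3j}) + 3j q^{6j}/(1−q^{6j}) ). -/
noncomputable section

section TriangleLambert

open Finset Filter Topology

/-- The finite `q`-Pochhammer symbol `(x; Q)_n`. -/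
def qPoch (x Q : ℂ) (n : ℕ) : ℂ := ∏ i ∈ range n, (1 - x * Q ^ i)

theorem prod_range_erase {M : Type*} [CommMonoid M] (f : ℕ → M) (i r : ℕ) :
    ∏ j ∈ (range (i + 1 + r)).erase i, f j =
      (∏ j ∈ range i, f j) * ∏ m ∈ range r, f (i + 1 + m) := by
  classical
  have h : ∏ j ∈ (range (i + 1 + r)).erase i, f j =
      ∏ j ∈ range (i + 1 + r), if j = i then 1 else f j := by
    rw [← Finset.prod_erase (range (i + 1 + r)) (f := fun j => if j = i then 1 else f j) (a := i)
      (if_pos rfl)]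
    refine prod_congr rfl fun j hj => ?_
    rw [if_neg (ne_of_mem_erase hj)]
  rw [h, prod_range_add, prod_range_succ]
  congr 1
  · rw [if_pos rfl, mul_one]
    refine prod_congr rfl fun j hj => ?_
    rw [if_neg (mem_range.1 hj).ne]
  · refine prod_congr rfl fun j _ => ?_
    rw [if_neg (by omega)]

/-- Partial fractions for a quotient of two monic split polynomials of the same degree. -/
theorem prod_div_prod_eq_one_add_sum {F ι : Type*} [Field F] [DecidableEq ι] (s : Finset ι)
    (v w : ι → F) (hv : Set.InjOn v s) {x : F} (hx : ∀ i ∈ s, x ≠ v i) :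
    (∏ i ∈ s, (x - w i)) / ∏ i ∈ s, (x - v i) =
      1 + ∑ i ∈ s, (∏ j ∈ s, (v i - w j)) / (∏ j ∈ s.erase i, (v i - v j)) / (x - v i) := by
  have hdeg : (Lagrange.nodal s w - Lagrange.nodal s v).degree < s.card := by
    rcases s.eq_empty_or_nonempty with rfl | hs
    · simp
    · have := Polynomial.degree_sub_lt_left (p := Lagrange.nodal s w) (q := Lagrange.nodal s v)
        (by simp) Lagrange.nodal_ne_zero
        (by rw [Lagrange.nodal_monic.leadingCoeff, Lagrange.nodal_monic.leadingCoeff])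
      simpa using this
  have h := congrArg (Polynomial.eval x) (Lagrange.eq_interpolate hv hdeg)
  rw [Lagrange.eval_interpolate_not_at_node _ hx, Polynomial.eval_sub, Lagrange.eval_nodal,
    Lagrange.eval_nodal] at h
  have h0 : ∏ i ∈ s, (x - v i) ≠ 0 := prod_ne_zero_iff.2 fun i hi => sub_ne_zero.2 (hx i hi)
  rw [sub_eq_iff_eq_add'] at h
  rw [h, add_div, div_self h0, mul_div_cancel_left₀ _ h0]
  congr 1
  refine sum_congr rfl fun i hi => ?_
  rw [Lagrange.nodalWeight, Polynomial.eval_sub, Lagrange.eval_nodal,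
    Lagrange.eval_nodal_at_node hi, prod_inv_distrib]
  field_simp
  ring

theorem qPoch_succ' (x Q : ℂ) (n : ℕ) : qPoch x Q (n + 1) = (1 - x) * qPoch (x * Q) Q n := by
  rw [qPoch, prod_range_succ', mul_comm, qPoch, pow_zero, mul_one]
  congr 1
  exact prod_congr rfl fun i _ => by ring

theorem prod_range_inv_pow_sub {z Q : ℂ} (hz : z ≠ 0) (hQ : Q ≠ 0) (i : ℕ) :
    ∏ j ∈ range i, ((Q ^ i)⁻¹ - (z * Q ^ j)⁻¹) = ((Q ^ i)⁻¹) ^ i * qPoch (Q / z) Q i := by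
  rw [qPoch, ← prod_range_reflect]
  conv_rhs => rw [show ((Q ^ i)⁻¹) ^ i = ∏ _j ∈ range i, (Q ^ i)⁻¹ by simp, ← prod_mul_distrib]
  refine prod_congr rfl fun j hj => ?_
  obtain ⟨r, rfl⟩ := Nat.exists_eq_add_of_le (Nat.succ_le_of_lt (mem_range.1 hj))
  have : j.succ + r - 1 - j = r := by omega
  rw [this, Nat.succ_eq_add_one]
  field_simp
  ring

theorem prod_range_inv_pow_sub_shift {z Q : ℂ} (hz : z ≠ 0) (hQ : Q ≠ 0) (i r : ℕ) :
    ∏ m ∈ range r, ((Q ^ i)⁻¹ - (z * Q ^ (i + 1 + m))⁻¹) =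
      (∏ m ∈ range r, -(Q ^ (i + 1 + m))⁻¹) * (z⁻¹) ^ r * qPoch (z * Q) Q r := by
  rw [qPoch]
  rw [show (z⁻¹) ^ r = ∏ _j ∈ range r, z⁻¹ by simp, ← prod_mul_distrib, ← prod_mul_distrib]
  refine prod_congr rfl fun j hj => ?_
  field_simp
  ring

theorem qPoch_self_ne_zero {Q : ℂ} (hQ : ∀ m : ℕ, Q ^ (m + 1) ≠ 1) (n : ℕ) : qPoch Q Q n ≠ 0 :=
  prod_ne_zero_iff.2 fun i _ => by
    rw [← pow_succ']
    exact sub_ne_zero.2 (hQ i).symm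

theorem qPoch_div_qPoch {a z Q : ℂ} (n : ℕ) (hz : z ≠ 0) (hQ : ∀ m : ℕ, Q ^ (m + 1) ≠ 1)
    (hQ0 : Q ≠ 0) (ha : ∀ i < n, a * Q ^ i ≠ 1) :
    qPoch (a * z) Q n / qPoch a Q n =
      z ^ n + ∑ k ∈ range n, z ^ k / (1 - a * Q ^ k) *
        (qPoch z Q (n - k) * qPoch (Q / z) Q k / (qPoch Q Q (n - 1 - k) * qPoch Q Q k)) := by
  have key := prod_div_prod_eq_one_add_sum (range n) (fun i => (Q ^ i)⁻¹)
    (fun i => (z * Q ^ i)⁻¹) ?_ (x := a) ?_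
  · have e1 : qPoch (a * z) Q n / qPoch a Q n = z ^ n * ((∏ i ∈ range n, (a - (z * Q ^ i)⁻¹)) /
        ∏ i ∈ range n, (a - (Q ^ i)⁻¹)) := by
      rw [qPoch, qPoch, ← prod_div_distrib, ← prod_div_distrib]
      nth_rw 2 [← card_range n]
      rw [← prod_const, ← prod_mul_distrib]
      refine prod_congr rfl fun i hi => ?_
      have h1 : 1 - a * Q ^ i ≠ 0 := sub_ne_zero.2 (ha i (mem_range.1 hi)).symm
      have h2 : a * Q ^ i - 1 ≠ 0 := sub_ne_zero.2 (ha i (mem_range.1 hi))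
      have h3 : a - (Q ^ i)⁻¹ = (a * Q ^ i - 1) / Q ^ i := by field_simp
      have h4 : a - (z * Q ^ i)⁻¹ = (a * z * Q ^ i - 1) / (z * Q ^ i) := by field_simp
      rw [h3, h4]
      field_simp
      ring
    rw [e1, key, mul_add, mul_one, mul_sum]
    congr 1
    refine sum_congr rfl fun i hi => ?_
    have hi' := mem_range.1 hi
    obtain ⟨r, rfl⟩ := Nat.exists_eq_add_of_le (Nat.succ_le_of_lt hi')
    have h1 : 1 - a * Q ^ i ≠ 0 := sub_ne_zero.2 (ha i (mem_range.1 hi)).symm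
    have h2 : a * Q ^ i - 1 ≠ 0 := sub_ne_zero.2 (ha i (mem_range.1 hi))
    have h3 : a - (Q ^ i)⁻¹ = (a * Q ^ i - 1) / Q ^ i := by field_simp
    simp only [Nat.succ_eq_add_one]
    have hr1 : i + 1 + r - i = r + 1 := by omega
    have hr2 : i + 1 + r - 1 - i = r := by omega
    rw [prod_range_erase, prod_range_add, hr1, hr2, prod_range_succ]
    have l1 := prod_range_inv_pow_sub one_ne_zero hQ0 i
    have l2 := prod_range_inv_pow_sub_shift one_ne_zero hQ0 i r
    simp only [one_mul, div_one, inv_one, one_pow, mul_one] at l1 l2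
    have hD : ∏ m ∈ range r, -(Q ^ (i + 1 + m))⁻¹ ≠ 0 :=
      prod_ne_zero_iff.2 fun m _ => neg_ne_zero.2 (inv_ne_zero (pow_ne_zero _ hQ0))
    rw [l1, l2, prod_range_inv_pow_sub hz hQ0, prod_range_inv_pow_sub_shift hz hQ0, h3,
      qPoch_succ']
    generalize (∏ m ∈ range r, -(Q ^ (i + 1 + m))⁻¹) = D at hD
    have q1 := qPoch_self_ne_zero hQ i
    have q2 := qPoch_self_ne_zero hQ r
    have h5 : 1 - a * Q ^ i = -(a * Q ^ i - 1) := by ring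
    rw [h5]
    rw [inv_pow z]
    field_simp
    ring
  · intro i hi j hj hij
    simp only [inv_inj] at hij
    wlog h : i < j generalizing i j
    · rcases lt_or_eq_of_le (not_lt.1 h) with h' | h'
      · exact (this hj hi hij.symm h').symm
      · exact h'.symm
    · obtain ⟨m, rfl⟩ := Nat.exists_eq_add_of_le (Nat.succ_le_of_lt h)
      refine absurd ?_ (hQ m)
      have : Q ^ i * Q ^ (m + 1) = Q ^ i * 1 := by rw [mul_one, ← pow_add, hij]; congr 1; omega
      exact mul_left_cancel₀ (pow_ne_zero _ hQ0) this
  · intro i hi h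
    exact ha i (mem_range.1 hi) (by rw [h, inv_mul_cancel₀ (pow_ne_zero _ hQ0)])

theorem qPoch_mul_inv_pow {x Q : ℂ} (hx : x ≠ 0) (hQ : Q ≠ 0) (N : ℕ) :
    qPoch (x * (Q ^ N)⁻¹) Q (N + N) =
      x ^ N * (∏ m ∈ range N, -(Q ^ (m + 1))⁻¹) * qPoch (Q / x) Q N * qPoch x Q N := by
  rw [qPoch, prod_range_add]
  congr 1
  · rw [← prod_range_reflect, qPoch, show x ^ N = ∏ _j ∈ range N, x by simp, ← prod_mul_distrib,
      ← prod_mul_distrib]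
    refine prod_congr rfl fun j hj => ?_
    obtain ⟨r, rfl⟩ := Nat.exists_eq_add_of_le (Nat.succ_le_of_lt (mem_range.1 hj))
    have : j.succ + r - 1 - j = r := by omega
    rw [this, Nat.succ_eq_add_one]
    field_simp
    ring
  · refine prod_congr rfl fun j hj => ?_
    field_simp
    ring

/-- The finite form of Kronecker's identity, as a sum over a symmetric interval. -/
theorem qPoch_div_qPoch_symm {a z Q : ℂ} (hz : z ≠ 0) (ha0 : a ≠ 0)
    (hQ : ∀ m : ℕ, Q ^ (m + 1) ≠ 1) (hQ0 : Q ≠ 0) (ha : ∀ i : ℤ, a * Q ^ i ≠ 1) (N : ℕ) :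
    qPoch (Q / (a * z)) Q N * qPoch (a * z) Q N / (qPoch (Q / a) Q N * qPoch a Q N) =
      z ^ N + ∑ k ∈ Ico (-(N : ℤ)) N, z ^ k / (1 - a * Q ^ k) *
        (qPoch z Q (N - k).toNat * qPoch (Q / z) Q (N + k).toNat /
          (qPoch Q Q (N - 1 - k).toNat * qPoch Q Q (N + k).toNat)) := by
  have h := qPoch_div_qPoch (a := a * (Q ^ N)⁻¹) (N + N) hz hQ hQ0 (fun i _ h => by
    refine ha (i - N) ?_
    rw [zpow_sub₀ hQ0, zpow_natCast, zpow_natCast, ← h]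
    field_simp)
  rw [mul_right_comm, qPoch_mul_inv_pow (mul_ne_zero ha0 hz) hQ0, qPoch_mul_inv_pow ha0 hQ0] at h
  have hD : ∏ m ∈ range N, -(Q ^ (m + 1))⁻¹ ≠ 0 :=
    prod_ne_zero_iff.2 fun m _ => neg_ne_zero.2 (inv_ne_zero (pow_ne_zero _ hQ0))
  have e : (a * z) ^ N * (∏ m ∈ range N, -(Q ^ (m + 1))⁻¹) * qPoch (Q / (a * z)) Q N *
      qPoch (a * z) Q N / (a ^ N * (∏ m ∈ range N, -(Q ^ (m + 1))⁻¹) * qPoch (Q / a) Q N *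
      qPoch a Q N) = z ^ N * (qPoch (Q / (a * z)) Q N * qPoch (a * z) Q N /
        (qPoch (Q / a) Q N * qPoch a Q N)) := by
    generalize (∏ m ∈ range N, -(Q ^ (m + 1))⁻¹) = D at hD
    rw [mul_pow, mul_assoc, mul_assoc _ (qPoch (Q / a) Q N), mul_div_mul_comm]
    congr 1
    field_simp
  rw [e] at h
  have hzN := pow_ne_zero N hz
  apply mul_left_cancel₀ hzN
  rw [h, mul_add, ← pow_add, mul_sum]
  congr 1
  refine sum_nbij' (fun k : ℕ => (k : ℤ) - N) (fun k => (k + N).toNat) ?_ ?_ ?_ ?_ ?_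
  · intro k hk
    simp only [mem_range] at hk
    simp only [mem_Ico]
    omega
  · intro k hk
    simp only [mem_Ico] at hk
    simp only [mem_range]
    omega
  · intro k hk
    simp
  · intro k hk
    simp only [mem_Ico] at hk
    omega
  · intro k hk
    have e1 : ((N : ℤ) - (k - N)).toNat = N + N - k := by omega
    have e2 : ((N : ℤ) + (k - N)).toNat = k := by omega
    have e3 : ((N : ℤ) - 1 - (k - N)).toNat = N + N - 1 - k := by omega
    rw [e1, e2, e3, zpow_sub₀ hz, zpow_sub₀ hQ0]
    simp only [zpow_natCast]
    rw [← mul_assoc]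
    congr 1
    rw [mul_assoc a, mul_comm _ (Q ^ k), ← div_eq_mul_inv]
    field_simp

/-- The infinite `q`-Pochhammer symbol `(x; Q)_∞`. -/
def qPochInf (x Q : ℂ) : ℂ := ∏' i : ℕ, (1 - x * Q ^ i)

theorem summable_norm_neg_mul_pow (x : ℂ) {Q : ℂ} (hQ : ‖Q‖ < 1) :
    Summable fun i : ℕ => ‖-(x * Q ^ i)‖ := by
  simpa using (summable_geometric_of_lt_one (norm_nonneg _) hQ).mul_left ‖x‖

theorem tendsto_qPoch (x : ℂ) {Q : ℂ} (hQ : ‖Q‖ < 1) :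
    Tendsto (qPoch x Q) atTop (𝓝 (qPochInf x Q)) := by
  have : Multipliable fun i : ℕ => 1 + -(x * Q ^ i) :=
    multipliable_one_add_of_summable (summable_norm_neg_mul_pow x hQ)
  simp only [← sub_eq_add_neg] at this
  exact this.tendsto_prod_tprod_nat

theorem qPochInf_ne_zero {x Q : ℂ} (hQ : ‖Q‖ < 1) (h : ∀ i : ℕ, x * Q ^ i ≠ 1) :
    qPochInf x Q ≠ 0 := by
  have := tprod_one_add_ne_zero_of_summable (f := fun i : ℕ => -(x * Q ^ i))
    (fun i => by rw [← sub_eq_add_neg]; exact sub_ne_zero.2 (h i).symm)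
    (summable_norm_neg_mul_pow x hQ)
  simp only [← sub_eq_add_neg] at this
  exact this

theorem exists_norm_le_of_tendsto {u : ℕ → ℂ} {l : ℂ} (h : Tendsto u atTop (𝓝 l)) :
    ∃ M, ∀ n, ‖u n‖ ≤ M := by
  obtain ⟨M, hM⟩ := h.norm.bddAbove_range
  exact ⟨M, fun n => hM ⟨n, rfl⟩⟩

theorem pow_succ_ne_one {Q : ℂ} (hQ : ‖Q‖ < 1) (m : ℕ) : Q ^ (m + 1) ≠ 1 := fun h => by
  have := congrArg norm h
  rw [norm_pow, norm_one] at this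
  exact (pow_lt_one₀ (norm_nonneg _) hQ m.succ_ne_zero).ne this

theorem summable_zpow_div_one_sub {a z Q : ℂ} (hQ0 : Q ≠ 0) (hQ : ‖Q‖ < 1) (hz : ‖z‖ < 1)
    (hQz : ‖Q‖ < ‖z‖) (ha0 : a ≠ 0) (ha : ∀ i : ℤ, a * Q ^ i ≠ 1) :
    Summable fun k : ℤ => ‖z ^ k / (1 - a * Q ^ k)‖ := by
  have hz0 : z ≠ 0 := norm_pos_iff.1 ((norm_nonneg _).trans_lt hQz)
  have hpow := tendsto_pow_atTop_nhds_zero_of_norm_lt_one hQ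
  refine Summable.of_nat_of_neg_add_one ?_ ?_
  · have ht : Tendsto (fun n : ℕ => (1 - a * Q ^ n)⁻¹) atTop (𝓝 (1 - a * 0)⁻¹) :=
      (tendsto_const_nhds.sub (hpow.const_mul a)).inv₀ (by simp)
    obtain ⟨M, hM⟩ := exists_norm_le_of_tendsto ht
    refine Summable.of_nonneg_of_le (fun _ => norm_nonneg _) (fun n => ?_)
      ((summable_geometric_of_lt_one (norm_nonneg z) hz).mul_right M)
    rw [div_eq_mul_inv, norm_mul, zpow_natCast, zpow_natCast, norm_pow]
    exact mul_le_mul_of_nonneg_left (hM n) (by positivity)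
  · have ht : Tendsto (fun n : ℕ => (Q ^ (n + 1) - a)⁻¹) atTop (𝓝 (0 - a)⁻¹) :=
      (((tendsto_add_atTop_iff_nat 1).2 hpow).sub tendsto_const_nhds).inv₀ (by simpa)
    obtain ⟨M, hM⟩ := exists_norm_le_of_tendsto ht
    have hr : ‖Q / z‖ < 1 := by rwa [norm_div, div_lt_one (norm_pos_iff.2 hz0)]
    refine Summable.of_nonneg_of_le (fun _ => norm_nonneg _) (fun n => ?_)
      (((summable_nat_add_iff 1).2
        (summable_geometric_of_lt_one (norm_nonneg (Q / z)) hr)).mul_right M)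
    have e : z ^ (-((n : ℤ) + 1)) / (1 - a * Q ^ (-((n : ℤ) + 1))) =
        (Q / z) ^ (n + 1) * (Q ^ (n + 1) - a)⁻¹ := by
      have h1 := ha (-((n : ℤ) + 1))
      have e1 : ∀ x : ℂ, x ^ (-((n : ℤ) + 1)) = (x ^ (n + 1))⁻¹ := fun x => by
        rw [zpow_neg]; norm_cast
      rw [e1] at h1
      rw [e1, e1, div_pow]
      have h2 : Q ^ (n + 1) ≠ 0 := pow_ne_zero _ hQ0
      have h3 : 1 - a * (Q ^ (n + 1))⁻¹ = (Q ^ (n + 1) - a) / Q ^ (n + 1) := by field_simp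
      rw [h3]
      field_simp
    rw [e, norm_mul, norm_pow]
    exact mul_le_mul_of_nonneg_left (hM n) (by positivity)

theorem tendsto_natCast_add_toNat (k : ℤ) :
    Tendsto (fun N : ℕ => ((N : ℤ) + k).toNat) atTop atTop :=
  tendsto_atTop.2 fun b => eventually_atTop.2 ⟨b + k.natAbs, fun n hn => by omega⟩

/-- Kronecker's bilateral Lambert series as an infinite product. -/
theorem tsum_zpow_div_one_sub {a z Q : ℂ} (hQ0 : Q ≠ 0) (hQ : ‖Q‖ < 1) (hz : ‖z‖ < 1)
    (hQz : ‖Q‖ < ‖z‖) (ha0 : a ≠ 0) (ha : ∀ i : ℤ, a * Q ^ i ≠ 1) :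
    (∑' k : ℤ, z ^ k / (1 - a * Q ^ k)) *
        (qPochInf z Q * qPochInf (Q / z) Q / (qPochInf Q Q * qPochInf Q Q)) =
      qPochInf (Q / (a * z)) Q * qPochInf (a * z) Q / (qPochInf (Q / a) Q * qPochInf a Q) := by
  have hz0 : z ≠ 0 := norm_pos_iff.1 ((norm_nonneg _).trans_lt hQz)
  have hQ1 := pow_succ_ne_one hQ
  have hne : qPochInf Q Q ≠ 0 := qPochInf_ne_zero hQ fun i => by
    rw [← pow_succ']; exact hQ1 i
  have hnea : qPochInf a Q ≠ 0 := qPochInf_ne_zero hQ fun i => by simpa using ha i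
  have hneQa : qPochInf (Q / a) Q ≠ 0 := qPochInf_ne_zero hQ fun i h => by
    refine ha (-(i + 1)) ?_
    have h1 : Q ^ (i + 1) = a := by
      field_simp at h
      rw [pow_succ', h]
    have e1 : Q ^ (-((i : ℤ) + 1)) = (Q ^ (i + 1))⁻¹ := by rw [zpow_neg]; norm_cast
    rw [e1, h1, mul_inv_cancel₀ ha0]
  have lhs : Tendsto (fun N : ℕ => qPoch (Q / (a * z)) Q N * qPoch (a * z) Q N /
      (qPoch (Q / a) Q N * qPoch a Q N) - z ^ N) atTop (𝓝 (qPochInf (Q / (a * z)) Q *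
        qPochInf (a * z) Q / (qPochInf (Q / a) Q * qPochInf a Q) - 0)) :=
    (((tendsto_qPoch _ hQ).mul (tendsto_qPoch _ hQ)).div
      ((tendsto_qPoch _ hQ).mul (tendsto_qPoch _ hQ)) (mul_ne_zero hneQa hnea)).sub
      (tendsto_pow_atTop_nhds_zero_of_norm_lt_one hz)
  obtain ⟨M₁, h₁⟩ := exists_norm_le_of_tendsto (tendsto_qPoch z hQ)
  obtain ⟨M₂, h₂⟩ := exists_norm_le_of_tendsto (tendsto_qPoch (Q / z) hQ)
  obtain ⟨M₃, h₃⟩ := exists_norm_le_of_tendsto ((tendsto_qPoch Q hQ).inv₀ hne)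
  have hM₁ := (norm_nonneg _).trans (h₁ 0)
  have hM₂ := (norm_nonneg _).trans (h₂ 0)
  have hM₃ := (norm_nonneg _).trans (h₃ 0)
  have rhs := tendsto_tsum_of_dominated_convergence (𝓕 := atTop)
    (f := fun (N : ℕ) (k : ℤ) => if k ∈ Ico (-(N : ℤ)) N then z ^ k / (1 - a * Q ^ k) *
        (qPoch z Q (N - k).toNat * qPoch (Q / z) Q (N + k).toNat /
          (qPoch Q Q (N - 1 - k).toNat * qPoch Q Q (N + k).toNat)) else 0)
    (g := fun k : ℤ => z ^ k / (1 - a * Q ^ k) *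
        (qPochInf z Q * qPochInf (Q / z) Q / (qPochInf Q Q * qPochInf Q Q)))
    (bound := fun k : ℤ => ‖z ^ k / (1 - a * Q ^ k)‖ * (M₁ * M₂ * (M₃ * M₃)))
    ((summable_zpow_div_one_sub hQ0 hQ hz hQz ha0 ha).mul_right _) ?_ ?_
  · rw [tsum_mul_right] at rhs
    rw [sub_zero] at lhs
    refine tendsto_nhds_unique (rhs.congr fun N => ?_) lhs
    rw [qPoch_div_qPoch_symm hz0 ha0 hQ1 hQ0 ha, add_sub_cancel_left,
      tsum_eq_sum (s := Ico (-(N : ℤ)) N) fun k hk => if_neg hk]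
    exact sum_congr rfl fun k hk => if_pos hk
  · intro k
    have t1 := tendsto_natCast_add_toNat (-k)
    have t2 := tendsto_natCast_add_toNat k
    have t3 := tendsto_natCast_add_toNat (-1 - k)
    have := ((((tendsto_qPoch z hQ).comp t1).mul ((tendsto_qPoch (Q / z) hQ).comp t2)).div
      (((tendsto_qPoch Q hQ).comp t3).mul ((tendsto_qPoch Q hQ).comp t2))
      (mul_ne_zero hne hne)).const_mul (z ^ k / (1 - a * Q ^ k))
    refine this.congr' (eventually_atTop.2 ⟨k.natAbs + 1, fun N hN => ?_⟩)
    have hk : k ∈ Ico (-(N : ℤ)) N := by rw [mem_Ico]; omega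
    have e : (N : ℤ) + (-1 - k) = N - 1 - k := by ring
    simp only [if_pos hk, Pi.div_apply, Function.comp, ← sub_eq_add_neg, e]
  · refine Eventually.of_forall fun N k => ?_
    split_ifs
    · rw [norm_mul, div_eq_mul_inv _ (_ * _), mul_inv, norm_mul (_ * _),
        norm_mul (qPoch z Q _), norm_mul (_)⁻¹]
      gcongr <;> apply_assumption
    · rw [norm_zero]; positivity

theorem qPoch_ne_zero {x Q : ℂ} (h : ∀ i : ℕ, x * Q ^ i ≠ 1) (n : ℕ) : qPoch x Q n ≠ 0 :=
  prod_ne_zero_iff.2 fun i _ => sub_ne_zero.2 (h i).symm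

/-- Shanks' finite form of Gauss' triangular number identity. -/
theorem sum_range_pow_triangle {q : ℂ} (hq : ‖q‖ < 1) (n : ℕ) :
    ∑ k ∈ range (2 * n), q ^ (k * (k + 1) / 2) =
      ∑ s ∈ range n, (qPoch (q ^ 2) (q ^ 2) n / qPoch q (q ^ 2) n) /
        (qPoch (q ^ 2) (q ^ 2) s / qPoch q (q ^ 2) s) * q ^ (s * (2 * n + 1)) := by
  have h1 : ∀ i : ℕ, 1 - q * (q ^ 2) ^ i ≠ 0 := fun i => by
    rw [← pow_mul, ← pow_succ']; exact sub_ne_zero.2 (pow_succ_ne_one hq _).symm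
  have h2 : ∀ i : ℕ, 1 - q ^ 2 * (q ^ 2) ^ i ≠ 0 := fun i => by
    rw [← pow_succ', ← pow_mul, mul_add, mul_one]
    exact sub_ne_zero.2 (pow_succ_ne_one hq _).symm
  set P : ℕ → ℂ := fun n => qPoch (q ^ 2) (q ^ 2) n / qPoch q (q ^ 2) n with hP
  have hP0 : ∀ n, P n ≠ 0 := fun n => div_ne_zero
    (qPoch_ne_zero (fun i => (sub_ne_zero.1 (h2 i)).symm) n)
    (qPoch_ne_zero (fun i => (sub_ne_zero.1 (h1 i)).symm) n)
  have hPs : ∀ n, P (n + 1) =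
      P n * ((1 - q ^ 2 * (q ^ 2) ^ n) / (1 - q * (q ^ 2) ^ n)) := fun n => by
    simp only [hP, qPoch, prod_range_succ]
    rw [mul_div_mul_comm]
  change _ = ∑ s ∈ range n, P n / P s * q ^ (s * (2 * n + 1))
  clear_value P
  induction n with
  | zero => simp
  | succ n ih =>
    have tele : ∀ s, P (n + 1) / P s * q ^ (s * (2 * (n + 1) + 1)) =
        P n / P s * q ^ (s * (2 * n + 1)) +
        (P n / P (s + 1) * q ^ ((s + 1) * (2 * n + 1)) * (1 - (q ^ 2) ^ (s + 1)) /
          (1 - q * (q ^ 2) ^ n) -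
        P n / P s * q ^ (s * (2 * n + 1)) * (1 - (q ^ 2) ^ s) / (1 - q * (q ^ 2) ^ n)) := by
      intro s
      have e1 := h1 n
      have e2 := h1 s
      have e3 := h2 s
      have e4 := hP0 s
      rw [hPs, hPs, pow_succ' (q ^ 2) s,
        show q ^ (s * (2 * (n + 1) + 1)) = q ^ (s * (2 * n + 1)) * (q ^ 2) ^ s by ring,
        show q ^ ((s + 1) * (2 * n + 1)) = q ^ (s * (2 * n + 1)) * (q * (q ^ 2) ^ n) by ring]
      generalize q ^ (s * (2 * n + 1)) = X
      generalize (q ^ 2) ^ s = S at *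
      generalize (q ^ 2) ^ n = T at *
      field_simp
      ring
    rw [show 2 * (n + 1) = 2 * n + 1 + 1 by ring, sum_range_succ, sum_range_succ, ih,
      sum_range_succ _ n, show 2 * n + 1 + 1 + 1 = 2 * (n + 1) + 1 by ring,
      sum_congr rfl fun s _ => tele s, sum_add_distrib,
      sum_range_sub (fun s => P n / P s * q ^ (s * (2 * n + 1)) * (1 - (q ^ 2) ^ s) /
        (1 - q * (q ^ 2) ^ n))]
    have t1 : 2 * n * (2 * n + 1) / 2 = n * (2 * n + 1) := by
      rw [mul_assoc]; exact Nat.mul_div_cancel_left _ two_pos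
    have t2 : (2 * n + 1) * (2 * n + 1 + 1) / 2 = (2 * n + 1) * (n + 1) := by
      rw [show (2 * n + 1) * (2 * n + 1 + 1) = 2 * ((2 * n + 1) * (n + 1)) by ring]
      exact Nat.mul_div_cancel_left _ two_pos
    have e1 := h1 n
    have e4 := hP0 n
    rw [t1, t2, hPs,
      show q ^ ((2 * n + 1) * (n + 1)) = q ^ (n * (2 * n + 1)) * (q * (q ^ 2) ^ n) by ring,
      show q ^ (n * (2 * (n + 1) + 1)) = q ^ (n * (2 * n + 1)) * (q ^ 2) ^ n by ring]
    generalize q ^ (n * (2 * n + 1)) = X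
    generalize (q ^ 2) ^ n = T at *
    field_simp
    ring

theorem summable_pow_triangle {q : ℂ} (hq : ‖q‖ < 1) :
    Summable fun n : ℕ => q ^ (n * (n + 1) / 2) := by
  refine Summable.of_norm_bounded (summable_geometric_of_lt_one (norm_nonneg q) hq) fun n => ?_
  rw [norm_pow]
  refine pow_le_pow_of_le_one (norm_nonneg _) hq.le ?_
  rw [Nat.le_div_iff_mul_le two_pos]
  nlinarith [Nat.le_mul_self n]

/-- Gauss' product for the generating function of the triangular numbers. -/
theorem tsum_pow_triangle {q : ℂ} (hq : ‖q‖ < 1) :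
    ∑' n : ℕ, q ^ (n * (n + 1) / 2) = qPochInf (q ^ 2) (q ^ 2) / qPochInf q (q ^ 2) := by
  have hq2 : ‖q ^ 2‖ < 1 := by
    rw [norm_pow]; exact pow_lt_one₀ (norm_nonneg _) hq two_ne_zero
  have hne1 : qPochInf q (q ^ 2) ≠ 0 := qPochInf_ne_zero hq2 fun i => by
    rw [← pow_mul, ← pow_succ']; exact pow_succ_ne_one hq _
  have hne2 : qPochInf (q ^ 2) (q ^ 2) ≠ 0 := qPochInf_ne_zero hq2 fun i => by
    rw [← pow_succ']; exact pow_succ_ne_one hq2 _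
  set P : ℕ → ℂ := fun n => qPoch (q ^ 2) (q ^ 2) n / qPoch q (q ^ 2) n with hP
  have hP1 : Tendsto P atTop (𝓝 (qPochInf (q ^ 2) (q ^ 2) / qPochInf q (q ^ 2))) :=
    (tendsto_qPoch _ hq2).div (tendsto_qPoch _ hq2) hne1
  obtain ⟨M, hM⟩ := exists_norm_le_of_tendsto hP1
  obtain ⟨M', hM'⟩ := exists_norm_le_of_tendsto (hP1.inv₀ (div_ne_zero hne2 hne1))
  have hM0 := (norm_nonneg _).trans (hM 0)
  have lim := tendsto_tsum_of_dominated_convergence (𝓕 := atTop)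
    (f := fun n s : ℕ => if s ∈ range n then P n / P s * q ^ (s * (2 * n + 1)) else 0)
    (g := fun s => if s = 0 then qPochInf (q ^ 2) (q ^ 2) / qPochInf q (q ^ 2) else 0)
    (bound := fun s => M * M' * ‖q‖ ^ s)
    ((summable_geometric_of_lt_one (norm_nonneg q) hq).mul_left _) ?_ ?_
  · rw [tsum_ite_eq] at lim
    have h2 : Tendsto (fun n : ℕ => 2 * n) atTop atTop :=
      tendsto_id.const_mul_atTop' two_pos
    refine tendsto_nhds_unique
      ((summable_pow_triangle hq).hasSum.tendsto_sum_nat.comp h2) (lim.congr fun n => ?_)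
    rw [tsum_eq_sum (s := range n) fun k hk => if_neg hk, Function.comp_apply,
      sum_range_pow_triangle hq]
    exact sum_congr rfl fun k hk => if_pos hk
  · intro s
    have hev : ∀ᶠ n in atTop, P n / P s * q ^ (s * (2 * n + 1)) =
        if s ∈ range n then P n / P s * q ^ (s * (2 * n + 1)) else 0 :=
      eventually_atTop.2 ⟨s + 1, fun n hn => (if_pos (mem_range.2 hn)).symm⟩
    refine Tendsto.congr' hev ?_
    split_ifs with hs
    · subst hs
      simpa [hP, qPoch] using hP1
    · have : Tendsto (fun n : ℕ => q ^ (s * (2 * n + 1))) atTop (𝓝 0) := by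
        refine (tendsto_pow_atTop_nhds_zero_of_norm_lt_one hq).comp
          (tendsto_atTop_mono (fun n => ?_) tendsto_id)
        have := Nat.pos_of_ne_zero hs
        simp only [id]
        nlinarith
      simpa using (hP1.div_const (P s)).mul this
  · refine Eventually.of_forall fun n s => ?_
    split_ifs
    · rw [norm_mul, div_eq_mul_inv, norm_mul, norm_pow]
      have hM1 := (norm_nonneg _).trans (hM' 0)
      exact mul_le_mul (mul_le_mul (hM n) (hM' s) (norm_nonneg _) hM0)
        (pow_le_pow_of_le_one (norm_nonneg _) hq.le (Nat.le_mul_of_pos_right _ (by omega)))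
        (by positivity) (by positivity)
    · rw [norm_zero]
      have := (norm_nonneg _).trans (hM' 0)
      positivity

theorem qPochInf_trisect (x : ℂ) {Q : ℂ} (hQ : ‖Q‖ < 1) :
    qPochInf x Q =
      qPochInf x (Q ^ 3) * qPochInf (x * Q) (Q ^ 3) * qPochInf (x * Q ^ 2) (Q ^ 3) := by
  have hQ3 : ‖Q ^ 3‖ < 1 := by
    rw [norm_pow]; exact pow_lt_one₀ (norm_nonneg _) hQ three_ne_zero
  have h3 : Tendsto (fun n : ℕ => 3 * n) atTop atTop := tendsto_id.const_mul_atTop' three_pos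
  refine tendsto_nhds_unique ((tendsto_qPoch x hQ).comp h3)
    ((((tendsto_qPoch x hQ3).mul (tendsto_qPoch (x * Q) hQ3)).mul
      (tendsto_qPoch (x * Q ^ 2) hQ3)).congr fun n => ?_)
  simp only [Function.comp_apply, qPoch]
  induction n with
  | zero => simp
  | succ n ih =>
    rw [show 3 * (n + 1) = 3 * n + 1 + 1 + 1 by ring, prod_range_succ _ (3 * n + 1 + 1),
      prod_range_succ _ (3 * n + 1), prod_range_succ _ (3 * n), ← ih, prod_range_succ,
      prod_range_succ, prod_range_succ]
    ring

theorem mul_zpow_pow_six_ne_one {q : ℂ} (hq0 : q ≠ 0) (hq : ‖q‖ < 1) (i : ℤ) :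
    q * (q ^ 6) ^ i ≠ 1 := fun h => by
  have e : q * (q ^ 6) ^ i = q ^ (6 * i + 1) := by
    rw [zpow_add₀ hq0, zpow_mul, zpow_one, mul_comm]; norm_cast
  rw [e] at h
  have h1 := congrArg norm h
  rw [norm_zpow, norm_one, zpow_eq_one_iff_right₀ (norm_nonneg _) hq.ne] at h1
  omega

/-- The Lambert series of `ψ(q) ψ(q³)`. -/
theorem tsum_triangle_mul_tsum_triangle {q : ℂ} (hq0 : q ≠ 0) (hq : ‖q‖ < 1) :
    (∑' n : ℕ, q ^ (n * (n + 1) / 2)) * (∑' n : ℕ, (q ^ 3) ^ (n * (n + 1) / 2)) =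
      ∑' k : ℤ, (q ^ 3) ^ k / (1 - q * (q ^ 6) ^ k) := by
  have hn : ∀ m : ℕ, ‖q ^ (m + 1)‖ < 1 := fun m => by
    rw [norm_pow]; exact pow_lt_one₀ (norm_nonneg _) hq m.succ_ne_zero
  have h36 : ‖q ^ 6‖ < ‖q ^ 3‖ := by
    rw [norm_pow, norm_pow]
    exact pow_lt_pow_right_of_lt_one₀ (norm_pos_iff.2 hq0) hq (by norm_num)
  have hne : ∀ m : ℕ, qPochInf (q ^ (m + 1)) (q ^ 6) ≠ 0 := fun m =>
    qPochInf_ne_zero (hn 5) fun i => by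
      rw [← pow_mul, ← pow_add, add_right_comm]; exact pow_succ_ne_one hq _
  have hq2 : ‖q ^ 2‖ < 1 := hn 1
  have hq3 : ‖q ^ 3‖ < 1 := hn 2
  have hq6 : ‖q ^ 6‖ < 1 := hn 5
  have key := tsum_zpow_div_one_sub (pow_ne_zero 6 hq0) hq6 hq3 h36 hq0
    (mul_zpow_pow_six_ne_one hq0 hq)
  have e1 : q ^ 6 / q ^ 3 = q ^ 3 := by field_simp
  have e2 : q * q ^ 3 = q ^ 4 := by ring
  have e3 : q ^ 6 / q ^ 4 = q ^ 2 := by field_simp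
  have e4 : q ^ 6 / q = q ^ 5 := by field_simp
  rw [e1, e2, e3, e4] at key
  rw [tsum_pow_triangle hq, tsum_pow_triangle hq3, qPochInf_trisect q hq2,
    qPochInf_trisect (q ^ 2) hq2, show (q ^ 2) ^ 3 = q ^ 6 by ring,
    show (q ^ 3) ^ 2 = q ^ 6 by ring, show q * q ^ 2 = q ^ 3 by ring,
    show q * (q ^ 2) ^ 2 = q ^ 5 by ring, show q ^ 2 * q ^ 2 = q ^ 4 by ring,
    show q ^ 2 * (q ^ 2) ^ 2 = q ^ 6 by ring]
  have n1 : qPochInf q (q ^ 6) ≠ 0 := by simpa using hne 0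
  have n3 : qPochInf (q ^ 3) (q ^ 6) ≠ 0 := hne 2
  have n5 : qPochInf (q ^ 5) (q ^ 6) ≠ 0 := hne 4
  have n6 : qPochInf (q ^ 6) (q ^ 6) ≠ 0 := hne 5
  rw [mul_div_assoc', div_eq_div_iff (mul_ne_zero n6 n6) (mul_ne_zero n5 n1)] at key
  rw [div_mul_div_comm, div_eq_iff (by simp [n1, n3, n5])]
  linear_combination -key

/-- A telescoping series over `ℤ` with an arbitrary integer step. -/
theorem hasSum_int_sub_of_tendsto {g : ℤ → ℂ} {A B : ℂ}
    (hs : Summable fun n : ℤ => g (n + 1) - g n)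
    (hA : Tendsto (fun n : ℕ => g n) atTop (𝓝 A))
    (hB : Tendsto (fun n : ℕ => g (-n)) atTop (𝓝 B)) (t : ℤ) :
    HasSum (fun n : ℤ => g (n + t) - g n) (t * (A - B)) := by
  have h1 : HasSum (fun n : ℤ => g (n + 1) - g n) (A - B) := by
    have hp : Summable fun n : ℕ => g ((n : ℤ) + 1) - g n :=
      hs.comp_injective Nat.cast_injective
    have hm : Summable fun n : ℕ => g (-((n : ℤ) + 1) + 1) - g (-((n : ℤ) + 1)) :=
      hs.comp_injective (i := fun n : ℕ => -((n : ℤ) + 1)) fun m n h => by simpa using h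
    have p : HasSum (fun n : ℕ => g ((n : ℤ) + 1) - g n) (A - g 0) := by
      refine (hp.hasSum_iff_tendsto_nat).2 ?_
      refine (hA.sub_const (g 0)).congr fun n => ?_
      have := sum_range_sub (fun k : ℕ => g k) n
      push_cast at this
      exact this.symm
    have m : HasSum (fun n : ℕ => g (-((n : ℤ) + 1) + 1) - g (-((n : ℤ) + 1))) (g 0 - B) := by
      refine (hm.hasSum_iff_tendsto_nat).2 ?_
      refine (hB.const_sub (g 0)).congr fun n => ?_
      have := sum_range_sub' (fun k : ℕ => g (-k)) n
      push_cast at this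
      rw [neg_zero] at this
      rw [← this]
      exact sum_congr rfl fun k _ => by congr 2; ring
    convert HasSum.of_nat_of_neg_add_one (f := fun n : ℤ => g (n + 1) - g n) p m using 1
    ring
  have h1t : ∀ t : ℤ, HasSum (fun n : ℤ => g (n + t + 1) - g (n + t)) (A - B) := fun t =>
    (Equiv.addRight t).hasSum_iff.2 h1
  induction t using Int.induction_on with
  | zero => simp
  | succ i ih =>
    convert ih.add (h1t i) using 1
    · ext n; rw [add_assoc n]; ring
    · push_cast; ring
  | pred i ih =>
    have h := ih.sub (h1t (-i - 1))
    rw [show ((-(i : ℤ) : ℤ) : ℂ) * (A - B) - (A - B) = ((-(i : ℤ) - 1 : ℤ) : ℂ) * (A - B) by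
      push_cast; ring] at h
    refine h.congr_fun fun n => ?_
    rw [show n + (-(i : ℤ) - 1) + 1 = n + -i by ring]
    ring

/-- The square of Kronecker's bilateral Lambert series at a half period. -/
theorem hasSum_int_mul_zpow_div_one_sub {a z : ℂ} (hz0 : z ≠ 0) (hz : ‖z‖ < 1) (ha0 : a ≠ 0)
    (ha : ∀ i : ℤ, a * (z ^ 2) ^ i ≠ 1) :
    HasSum (fun t : ℤ => t * (z ^ t / (1 - (z ^ 2) ^ t)))
      (∑' n : ℤ, a * (z ^ 2) ^ n / (1 - a * (z ^ 2) ^ n) ^ 2 -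
        a * (∑' k : ℤ, z ^ k / (1 - a * (z ^ 2) ^ k)) ^ 2) := by
  have hQ0 : z ^ 2 ≠ 0 := pow_ne_zero 2 hz0
  have hQ : ‖z ^ 2‖ < 1 := by
    rw [norm_pow]; exact pow_lt_one₀ (norm_nonneg _) hz two_ne_zero
  have hQz : ‖z ^ 2‖ < ‖z‖ := by
    rw [norm_pow]; exact pow_lt_self_of_lt_one₀ (norm_pos_iff.2 hz0) hz one_lt_two
  have hsum := summable_zpow_div_one_sub hQ0 hQ hz hQz ha0 ha
  set f : ℤ → ℂ := fun k => z ^ k / (1 - a * (z ^ 2) ^ k) with hf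
  set g : ℤ → ℂ := fun k => (1 - a * (z ^ 2) ^ k)⁻¹ with hg
  have hprod : HasSum (fun p : ℤ × ℤ => a * (f p.2 * f (p.2 + p.1))) (a * (∑' k, f k) ^ 2) := by
    have h := (summable_mul_of_summable_norm hsum hsum).hasSum.mul_left a
    rw [← tsum_mul_tsum_of_summable_norm hsum hsum, ← sq] at h
    let e : ℤ × ℤ ≃ ℤ × ℤ :=
      { toFun := fun p => (p.2, p.2 + p.1)
        invFun := fun p => (p.2 - p.1, p.1)
        left_inv := fun p => by simp
        right_inv := fun p => by simp }
    exact e.hasSum_iff.2 h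
  have hd : ∀ k : ℤ, 1 - a * (z ^ 2) ^ k ≠ 0 := fun k => sub_ne_zero.2 (ha k).symm
  have hone : ∀ t : ℤ, t ≠ 0 → 1 - (z ^ 2) ^ t ≠ 0 := fun t ht h => by
    have h1 := congrArg norm (sub_eq_zero.1 h)
    rw [norm_zpow, norm_one, eq_comm, zpow_eq_one_iff_right₀ (norm_nonneg _) hQ.ne] at h1
    exact ht h1
  have hff : ∀ t : ℤ, t ≠ 0 → ∀ n : ℤ, a * (f n * f (n + t)) =
      -(z ^ t / (1 - (z ^ 2) ^ t)) * (g (n + t) - g n) := by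
    intro t ht n
    have h1 := hd n
    have h2 := hd (n + t)
    have h3 := hone t ht
    have e : z ^ n * z ^ n = (z ^ 2) ^ n := by rw [← mul_zpow, sq]
    simp only [hf, hg]
    rw [zpow_add₀ hQ0] at h2 ⊢
    rw [zpow_add₀ hz0, inv_sub_inv h2 h1, div_mul_div_comm, mul_div_assoc', neg_mul,
      div_mul_div_comm, ← neg_div, div_eq_div_iff (mul_ne_zero h1 h2)
      (mul_ne_zero h3 (mul_ne_zero h2 h1))]
    rw [show z ^ n * (z ^ n * z ^ t) = z ^ n * z ^ n * z ^ t by ring, e]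
    ring
  have hpow := tendsto_pow_atTop_nhds_zero_of_norm_lt_one hQ
  have hA : Tendsto (fun n : ℕ => g n) atTop (𝓝 1) := by
    have : Tendsto (fun n : ℕ => (1 - a * (z ^ 2) ^ n)⁻¹) atTop (𝓝 (1 - a * 0)⁻¹) :=
      (tendsto_const_nhds.sub (hpow.const_mul a)).inv₀ (by simp)
    simpa [hg] using this
  have hB : Tendsto (fun n : ℕ => g (-n)) atTop (𝓝 0) := by
    have : Tendsto (fun n : ℕ => (z ^ 2) ^ n / ((z ^ 2) ^ n - a)) atTop (𝓝 (0 / (0 - a))) :=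
      hpow.div (hpow.sub_const a) (by simpa)
    rw [zero_div] at this
    refine this.congr fun n => ?_
    have h2 : (z ^ 2) ^ n ≠ 0 := pow_ne_zero _ hQ0
    simp only [hg]
    rw [zpow_neg, zpow_natCast, show 1 - a * ((z ^ 2) ^ n)⁻¹ = ((z ^ 2) ^ n - a) / (z ^ 2) ^ n by
      field_simp, inv_div]
  have hsg : Summable fun n : ℤ => g (n + 1) - g n := by
    have h := hprod.summable.prod_factor 1
    simp only [hff 1 one_ne_zero] at h
    exact (summable_mul_left_iff
      (neg_ne_zero.2 (div_ne_zero (zpow_ne_zero _ hz0) (hone 1 one_ne_zero)))).1 h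
  have hfib : ∀ t : ℤ, HasSum (fun n : ℤ => a * (f n * f (n + t)))
      ((if t = 0 then ∑' n : ℤ, a * (z ^ 2) ^ n / (1 - a * (z ^ 2) ^ n) ^ 2 else 0) -
        t * (z ^ t / (1 - (z ^ 2) ^ t))) := by
    intro t
    by_cases ht : t = 0
    · subst ht
      have h := (hprod.summable.prod_factor 0).hasSum
      have e : ∀ n : ℤ, a * (f n * f (n + 0)) = a * (z ^ 2) ^ n / (1 - a * (z ^ 2) ^ n) ^ 2 := by
        intro n
        simp only [hf, add_zero]
        rw [div_mul_div_comm, mul_div_assoc', ← mul_zpow, ← sq, ← sq]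
      simp only [e] at h ⊢
      simpa using h
    · rw [if_neg ht]
      simp only [hff t ht]
      rw [show (0 : ℂ) - t * (z ^ t / (1 - (z ^ 2) ^ t)) =
        -(z ^ t / (1 - (z ^ 2) ^ t)) * (t * (1 - 0)) by ring]
      exact (hasSum_int_sub_of_tendsto hsg hA hB t).mul_left _
  have htot := hprod.prod_fiberwise hfib
  have h := (hasSum_ite_eq (0 : ℤ)
    (∑' n : ℤ, a * (z ^ 2) ^ n / (1 - a * (z ^ 2) ^ n) ^ 2)).sub htot
  simpa only [sub_sub_cancel] using h

theorem summable_succ_mul_pow {y : ℂ} (hy : ‖y‖ < 1) :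
    Summable fun j : ℕ => ((j : ℝ) + 1) * ‖y‖ ^ (j + 1) := by
  have h := (summable_nat_add_iff 1).2
    (hasSum_coe_mul_geometric_of_norm_lt_one (r := ‖y‖) (by simpa)).summable
  simpa using h

theorem summable_succ_mul_pow_div_one_sub {y Q : ℂ} (hy : ‖y‖ < 1) (hQ : ‖Q‖ < 1) :
    Summable fun j : ℕ => ((j : ℂ) + 1) * (y ^ (j + 1) / (1 - Q ^ (j + 1))) := by
  have ht : Tendsto (fun n : ℕ => (1 - Q ^ (n + 1))⁻¹) atTop (𝓝 (1 - 0)⁻¹) :=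
    (tendsto_const_nhds.sub ((tendsto_add_atTop_iff_nat 1).2
      (tendsto_pow_atTop_nhds_zero_of_norm_lt_one hQ))).inv₀ (by simp)
  obtain ⟨M, hM⟩ := exists_norm_le_of_tendsto ht
  refine Summable.of_norm_bounded ((summable_succ_mul_pow hy).mul_right M) fun j => ?_
  have e : ‖(j : ℂ) + 1‖ = (j : ℝ) + 1 := by
    rw [← Nat.cast_succ, Complex.norm_natCast, Nat.cast_succ]
  rw [div_eq_mul_inv, norm_mul, norm_mul, norm_pow, e, ← mul_assoc]
  exact mul_le_mul_of_nonneg_left (hM j) (by positivity)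

theorem hasSum_succ_mul_pow {w : ℂ} (hw : ‖w‖ < 1) :
    HasSum (fun j : ℕ => ((j : ℂ) + 1) * w ^ (j + 1)) (w / (1 - w) ^ 2) := by
  have h := (hasSum_nat_add_iff' (f := fun n : ℕ => (n : ℂ) * w ^ n) 1).2
    (hasSum_coe_mul_geometric_of_norm_lt_one hw)
  simpa using h

theorem hasSum_div_one_sub_sq {y Q : ℂ} (hy : ‖y‖ < 1) (hQ : ‖Q‖ < 1) :
    HasSum (fun n : ℕ => y * Q ^ n / (1 - y * Q ^ n) ^ 2)
      (∑' j : ℕ, ((j : ℂ) + 1) * (y ^ (j + 1) / (1 - Q ^ (j + 1)))) := by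
  have hs : Summable fun p : ℕ × ℕ => ((p.2 : ℂ) + 1) * (y * Q ^ p.1) ^ (p.2 + 1) := by
    refine Summable.of_norm_bounded ((summable_geometric_of_lt_one (norm_nonneg Q) hQ).mul_of_nonneg
      (summable_succ_mul_pow hy) (fun n => by positivity) (fun n => by positivity)) fun p => ?_
    have e : ‖(p.2 : ℂ) + 1‖ = (p.2 : ℝ) + 1 := by
      rw [← Nat.cast_succ, Complex.norm_natCast, Nat.cast_succ]
    rw [norm_mul, norm_pow, norm_mul, mul_pow, norm_pow, e, mul_comm (‖Q‖ ^ p.1), ← mul_assoc]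
    refine mul_le_mul_of_nonneg_left ?_ (by positivity)
    rw [← pow_mul]
    exact pow_le_pow_of_le_one (norm_nonneg _) hQ.le (Nat.le_mul_of_pos_right _ p.2.succ_pos)
  have h1 : ∀ n : ℕ, HasSum (fun j : ℕ => ((j : ℂ) + 1) * (y * Q ^ n) ^ (j + 1))
      (y * Q ^ n / (1 - y * Q ^ n) ^ 2) := fun n => by
    have hw : ‖y * Q ^ n‖ < 1 := by
      rw [norm_mul, norm_pow]
      exact (mul_le_of_le_one_right (norm_nonneg _) (pow_le_one₀ (norm_nonneg _) hQ.le)).trans_lt hy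
    exact hasSum_succ_mul_pow hw
  have h2 : ∀ j : ℕ, HasSum (fun n : ℕ => ((j : ℂ) + 1) * (y * Q ^ n) ^ (j + 1))
      (((j : ℂ) + 1) * (y ^ (j + 1) / (1 - Q ^ (j + 1)))) := fun j => by
    have hw : ‖Q ^ (j + 1)‖ < 1 := by
      rw [norm_pow]; exact pow_lt_one₀ (norm_nonneg _) hQ j.succ_ne_zero
    have := ((hasSum_geometric_of_norm_lt_one hw).mul_left (y ^ (j + 1))).mul_left ((j : ℂ) + 1)
    have e : (fun n : ℕ => ((j : ℂ) + 1) * (y * Q ^ n) ^ (j + 1)) =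
        fun n : ℕ => ((j : ℂ) + 1) * (y ^ (j + 1) * (Q ^ (j + 1)) ^ n) := by
      funext n
      rw [mul_pow, ← pow_mul, ← pow_mul, mul_comm n]
    rw [e, div_eq_mul_inv]
    exact this
  have hs' : HasSum (fun p : ℕ × ℕ => ((p.1 : ℂ) + 1) * (y * Q ^ p.2) ^ (p.1 + 1))
      (∑' p : ℕ × ℕ, ((p.2 : ℂ) + 1) * (y * Q ^ p.1) ^ (p.2 + 1)) :=
    (Equiv.prodComm ℕ ℕ).hasSum_iff.2 hs.hasSum
  have h3 := hs.hasSum.prod_fiberwise h1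
  have h4 := hs'.prod_fiberwise h2
  rw [h4.tsum_eq]
  exact h3

theorem zpow_neg_natCast_succ (x : ℂ) (n : ℕ) : x ^ (-((n : ℤ) + 1)) = (x ^ (n + 1))⁻¹ := by
  rw [zpow_neg]; norm_cast

theorem tsum_int_div_one_sub_sq {a Q : ℂ} (hQ0 : Q ≠ 0) (hQ : ‖Q‖ < 1) (ha0 : a ≠ 0)
    (ha1 : ‖a‖ < 1) (hQa : ‖Q / a‖ < 1) :
    ∑' n : ℤ, a * Q ^ n / (1 - a * Q ^ n) ^ 2 =
      (∑' j : ℕ, ((j : ℂ) + 1) * (a ^ (j + 1) / (1 - Q ^ (j + 1)))) +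
      ∑' j : ℕ, ((j : ℂ) + 1) * ((Q / a) ^ (j + 1) / (1 - Q ^ (j + 1))) := by
  refine (HasSum.of_nat_of_neg_add_one ?_ ?_).tsum_eq
  · simpa only [zpow_natCast] using hasSum_div_one_sub_sq ha1 hQ
  · convert hasSum_div_one_sub_sq hQa hQ using 1
    ext n
    rw [zpow_neg_natCast_succ, pow_succ']
    have h1 : Q ^ n ≠ 0 := pow_ne_zero _ hQ0
    have e1 : 1 - a * (Q * Q ^ n)⁻¹ = (Q * Q ^ n - a) / (Q * Q ^ n) := by field_simp
    have e2 : 1 - Q / a * Q ^ n = -(Q * Q ^ n - a) / a := by field_simp; ring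
    rw [e1, e2, div_pow, div_pow, neg_sq]
    field_simp

theorem tsum_int_mul_zpow_div_one_sub {z Q : ℂ} (hQ0 : Q ≠ 0) (hQ : ‖Q‖ < 1) (hz0 : z ≠ 0)
    (hz : ‖z‖ < 1) (hQz : ‖Q / z‖ < 1) :
    ∑' t : ℤ, t * (z ^ t / (1 - Q ^ t)) =
      (∑' j : ℕ, ((j : ℂ) + 1) * (z ^ (j + 1) / (1 - Q ^ (j + 1)))) +
      ∑' j : ℕ, ((j : ℂ) + 1) * ((Q / z) ^ (j + 1) / (1 - Q ^ (j + 1))) := by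
  have h := HasSum.of_add_one_of_neg_add_one (f := fun t : ℤ => (t : ℂ) * (z ^ t / (1 - Q ^ t)))
    (m := ∑' j : ℕ, ((j : ℂ) + 1) * (z ^ (j + 1) / (1 - Q ^ (j + 1))))
    (m' := ∑' j : ℕ, ((j : ℂ) + 1) * ((Q / z) ^ (j + 1) / (1 - Q ^ (j + 1)))) ?_ ?_
  · simpa using h.tsum_eq
  · convert (summable_succ_mul_pow_div_one_sub hz hQ).hasSum using 1
    ext j
    push_cast
    norm_cast
  · convert (summable_succ_mul_pow_div_one_sub hQz hQ).hasSum using 1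
    ext j
    rw [zpow_neg_natCast_succ, zpow_neg_natCast_succ, div_pow]
    have h1 : Q ^ (j + 1) ≠ 0 := pow_ne_zero _ hQ0
    have h2 : 1 - Q ^ (j + 1) ≠ 0 := sub_ne_zero.2 (pow_succ_ne_one hQ j).symm
    have e1 : 1 - (Q ^ (j + 1))⁻¹ = -(1 - Q ^ (j + 1)) / Q ^ (j + 1) := by field_simp; ring
    rw [e1]
    push_cast
    field_simp

theorem mul_triangle_sq_mul_triangle_sq {q : ℂ} (hq0 : q ≠ 0) (hq : ‖q‖ < 1) :
    q * (∑' n : ℕ, q ^ (n * (n + 1) / 2)) ^ 2 * (∑' n : ℕ, (q ^ 3) ^ (n * (n + 1) / 2)) ^ 2 =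
      ∑' j : ℕ, ((j : ℂ) + 1) * ((q ^ (j + 1) - 2 * (q ^ 3) ^ (j + 1) + (q ^ 5) ^ (j + 1)) /
        (1 - (q ^ 6) ^ (j + 1))) := by
  have hn : ∀ m : ℕ, m ≠ 0 → ‖q ^ m‖ < 1 := fun m hm => by
    rw [norm_pow]; exact pow_lt_one₀ (norm_nonneg _) hq hm
  have hq3 := hn 3 (by norm_num)
  have hq5 := hn 5 (by norm_num)
  have hq6 := hn 6 (by norm_num)
  have e6 : (q ^ 3) ^ 2 = q ^ 6 := by ring
  have e63 : q ^ 6 / q ^ 3 = q ^ 3 := by field_simp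
  have e61 : q ^ 6 / q = q ^ 5 := by field_simp
  have h := (hasSum_int_mul_zpow_div_one_sub (pow_ne_zero 3 hq0) hq3 hq0
    (by rw [e6]; exact mul_zpow_pow_six_ne_one hq0 hq)).tsum_eq
  rw [e6, tsum_int_mul_zpow_div_one_sub (pow_ne_zero 6 hq0) hq6 (pow_ne_zero 3 hq0) hq3
      (by rwa [e63]),
    tsum_int_div_one_sub_sq (pow_ne_zero 6 hq0) hq6 hq0 hq (by rwa [e61]), e63, e61,
    ← tsum_triangle_mul_tsum_triangle hq0 hq] at h
  have s1 := (summable_succ_mul_pow_div_one_sub hq hq6).hasSum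
  have s3 := (summable_succ_mul_pow_div_one_sub hq3 hq6).hasSum
  have s5 := (summable_succ_mul_pow_div_one_sub hq5 hq6).hasSum
  have hs := ((s1.add s5).sub (s3.add s3)).tsum_eq
  rw [h] at hs
  rw [mul_assoc, ← mul_pow]
  refine Eq.trans ?_ (hs.symm.trans (tsum_congr fun j => ?_))
  · ring
  · ring

theorem lambert_combination {y : ℂ} (h : y ^ 6 ≠ 1) :
    y / (1 - y) - y ^ 2 / (1 - y ^ 2) - 3 * (y ^ 3 / (1 - y ^ 3)) + 3 * (y ^ 6 / (1 - y ^ 6)) =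
      (y - 2 * y ^ 3 + y ^ 5) / (1 - y ^ 6) := by
  have h6 := sub_ne_zero.2 h.symm
  have h1 : 1 - y ≠ 0 := fun e => h6 (by linear_combination (1 + y + y^2 + y^3 + y^4 + y^5) * e)
  have h2 : 1 - y ^ 2 ≠ 0 := fun e => h6 (by linear_combination (1 + y^2 + y^4) * e)
  have h3 : 1 - y ^ 3 ≠ 0 := fun e => h6 (by linear_combination (1 + y^3) * e)
  have i1 : y / (1 - y) = y * (1 + y + y^2 + y^3 + y^4 + y^5) / (1 - y ^ 6) := by
    rw [div_eq_div_iff h1 h6]; ring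
  have i2 : y ^ 2 / (1 - y ^ 2) = y ^ 2 * (1 + y^2 + y^4) / (1 - y ^ 6) := by
    rw [div_eq_div_iff h2 h6]; ring
  have i3 : y ^ 3 / (1 - y ^ 3) = y ^ 3 * (1 + y^3) / (1 - y ^ 6) := by
    rw [div_eq_div_iff h3 h6]; ring
  rw [i1, i2, i3]
  ring

end TriangleLambert

theorem statement5 (q : ℂ) (hq : ‖q‖ < 1) :
    q * (∑' n : ℕ, (q) ^ (n * (n + 1) / 2)) ^ 2 * (∑' n : ℕ, (q ^ 3) ^ (n * (n + 1) / 2)) ^ 2 =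
      ∑' j : ℕ,
        (((j : ℂ) + 1) * q ^ (1 * (j + 1)) / (1 - q ^ (1 * (j + 1))) - ((j : ℂ) + 1) * q ^ (2 * (j + 1)) / (1 - q ^ (2 * (j + 1))) - 3 * ((j : ℂ) + 1) * q ^ (3 * (j + 1)) / (1 - q ^ (3 * (j + 1))) + 3 * ((j : ℂ) + 1) * q ^ (6 * (j + 1)) / (1 - q ^ (6 * (j + 1)))) := by
  rcases eq_or_ne q 0 with rfl | hq0
  · simp
  rw [mul_triangle_sq_mul_triangle_sq hq0 hq]
  refine tsum_congr fun j => ?_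
  have e : ∀ c : ℕ, q ^ (c * (j + 1)) = (q ^ (j + 1)) ^ c := fun c => by
    rw [mul_comm, pow_mul]
  have h6 : (q ^ (j + 1)) ^ 6 ≠ 1 := by
    rw [← pow_mul, show (j + 1) * 6 = 6 * j + 5 + 1 by ring]
    exact pow_succ_ne_one hq _
  have e' : ∀ c : ℕ, (q ^ c) ^ (j + 1) = (q ^ (j + 1)) ^ c := fun c => pow_right_comm q c (j + 1)
  simp only [e, e', pow_one]
  rw [← lambert_combination h6]
  ring
end
end
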